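/- arXiv:1509.04977 — 5 statements merged into one kernel-verified Lean document; each statement's English description precedes it below -/
import Mathlib

section
/- Fix integers n ≥ 3 and k ≥ 1. Define ideals of R = K[x,y,z] by J_0 = (f,g)^{k(n−3)} and, for 0 ≤ i ≤ k−1, J_{3i+1} = (f,g)^{k(n−3)+3i+1} ∩ (x,y)^{(i+1)n} ∩ (y,z)^{in} ∩ (x,z)^{in}, J_{3i+2} = (f,g)^{k(n−3)+3i+2} ∩ (x,y)^{(i+1)n} ∩ (y,z)^{(i+1)n} ∩ (x,z)^{in}, and J_{3i+3} = (f,g)^{k(n−3)+3i+3} ∩ (x,y)^{(i+1)n} ∩ (y,z)^{(i+1)n} ∩ (x,z)^{(i+1)n}. Then for every 0 ≤ i ≤ k−1 the following recursions hold: J_{3i+1} = h·J_{3i} + f^{(k−1−i)(n−3)+2i+1} g^{(i+1)(n−2)−1} x^{in+1} · (x, y)^{n−1}; J_{3i+2} = f·J_{3i+1} + g^{(k−1−i)(n−3)+2i+1} h^{(i+1)(n−2)} y^{in+1} · (y, z)^{n−1}; J_{3i+3} = g·J_{3i+2} + f^{(i+1)(n−2)} h^{(k−1−i)(n−3)+2i+2}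 z^{in+1} · (x, z)^{n−1}. -/
open MvPolynomial

noncomputable section

/-- `f = yⁿ − zⁿ` in `K[x,y,z]` (variables `x = X 0`, `y = X 1`, `z = X 2`). -/
def pf (K : Type*) [Field K] (n : ℕ) : MvPolynomial (Fin 3) K := X 1 ^ n - X 2 ^ n

/-- `g = zⁿ − xⁿ`. -/
def pg (K : Type*) [Field K] (n : ℕ) : MvPolynomial (Fin 3) K := X 2 ^ n - X 0 ^ n

/-- `h = xⁿ − yⁿ`. -/
def ph (K : Type*) [Field K] (n : ℕ) : MvPolynomial (Fin 3) K := X 0 ^ n - X 1 ^ n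

/-- The ideal `(f, g)`. -/
def Ifg (K : Type*) [Field K] (n : ℕ) : Ideal (MvPolynomial (Fin 3) K) :=
  Ideal.span {pf K n, pg K n}

/-- The ideal `(x, y)`. -/
def Ixy (K : Type*) [Field K] : Ideal (MvPolynomial (Fin 3) K) := Ideal.span {X 0, X 1}

/-- The ideal `(y, z)`. -/
def Iyz (K : Type*) [Field K] : Ideal (MvPolynomial (Fin 3) K) := Ideal.span {X 1, X 2}

/-- The ideal `(z, x)`. -/
def Izx (K : Type*) [Field K] : Ideal (MvPolynomial (Fin 3) K) := Ideal.span {X 2, X 0}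

/-- The `m`-th symbolic power of the Fermat ideal `I = (xf, yg, zh)`:
`I^{(m)} = (f,g)^m ∩ (x,y)^m ∩ (y,z)^m ∩ (z,x)^m`. -/
def symbPow (K : Type*) [Field K] (n m : ℕ) : Ideal (MvPolynomial (Fin 3) K) :=
  Ifg K n ^ m ⊓ Ixy K ^ m ⊓ Iyz K ^ m ⊓ Izx K ^ m

section SpanPair

variable {R : Type*} [CommRing R]

theorem span_pair_pow_succ_le (a b : R) (k : ℕ) :
    Ideal.span {a, b} ^ (k + 1) ≤
      Ideal.span {a} * Ideal.span {a, b} ^ k ⊔ Ideal.span {b ^ (k + 1)} := by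
  induction k with
  | zero => simp [← Ideal.span_insert]
  | succ k ih =>
    have hb : Ideal.span {b} ≤ Ideal.span {a, b} := Ideal.span_mono (by simp)
    calc Ideal.span {a, b} ^ (k + 1 + 1)
        = Ideal.span {a} * Ideal.span {a, b} ^ (k + 1) ⊔
            Ideal.span {b} * Ideal.span {a, b} ^ (k + 1) := by
          rw [pow_succ' _ (k + 1), ← Ideal.sup_mul, ← Ideal.span_insert]
      _ ≤ Ideal.span {a} * Ideal.span {a, b} ^ (k + 1) ⊔ Ideal.span {b} *
            (Ideal.span {a} * Ideal.span {a, b} ^ k ⊔ Ideal.span {b ^ (k + 1)}) :=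
          sup_le_sup_left (Ideal.mul_mono_right ih) _
      _ ≤ _ := by
          rw [Ideal.mul_sup, Ideal.span_singleton_mul_span_singleton, ← pow_succ' b,
            ← sup_assoc, mul_left_comm]
          refine sup_le_sup_right (sup_le le_rfl ?_) _
          rw [pow_succ' _ k]
          exact Ideal.mul_mono_right (Ideal.mul_mono_left hb)

theorem exists_of_mem_span_pair_pow_succ {a b d : R} {k : ℕ}
    (hd : d ∈ Ideal.span {a, b} ^ (k + 1)) :
    ∃ c ∈ Ideal.span {a, b} ^ k, ∃ e, d = a * c + b ^ (k + 1) * e := by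
  obtain ⟨s, hs, t, ht, rfl⟩ := Submodule.mem_sup.1 (span_pair_pow_succ_le a b k hd)
  obtain ⟨c, hc, rfl⟩ := Ideal.mem_span_singleton_mul.1 hs
  obtain ⟨e, rfl⟩ := Ideal.mem_span_singleton.1 ht
  exact ⟨c, hc, e, rfl⟩

/-- If `a, b` is a regular sequence, then `(a, b) ^ (k + 1) : a ≤ (a, b) ^ k`. -/
theorem mem_span_pair_pow_of_mul_mem [IsDomain R] {a b c : R} {k : ℕ} (ha : a ≠ 0)
    (hab : ∀ e, a ∣ b ^ (k + 1) * e → a ∣ e) (hc : a * c ∈ Ideal.span {a, b} ^ (k + 1)) :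
    c ∈ Ideal.span {a, b} ^ k := by
  obtain ⟨s, hs, e, he⟩ := exists_of_mem_span_pair_pow_succ hc
  obtain ⟨t, rfl⟩ := hab e ⟨c - s, by linear_combination -he⟩
  have hcs : c = s + b ^ (k + 1) * t := mul_left_cancel₀ ha (by linear_combination he)
  rw [hcs]
  exact add_mem hs (Ideal.mul_mem_right _ _ (Ideal.pow_le_pow_right k.le_succ
    (Ideal.pow_mem_pow (Ideal.subset_span (by simp)) _)))

theorem span_pair_pow_add_le (u v : R) (l N : ℕ) :
    Ideal.span {u, v} ^ (N + (l + 1)) ≤ Ideal.span {u ^ (l + 1) - v ^ (l + 1)} ⊔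
      Ideal.span {u ^ (N + 1)} * Ideal.span {u, v} ^ l := by
  have hu : u ∈ Ideal.span {u, v} := Ideal.subset_span (by simp)
  have base : Ideal.span {u, v} ^ (l + 1) ≤ Ideal.span {u ^ (l + 1) - v ^ (l + 1)} ⊔
      Ideal.span {u} * Ideal.span {u, v} ^ l := by
    refine (span_pair_pow_succ_le u v l).trans (sup_le le_sup_right ?_)
    have hv : v ^ (l + 1) = u ^ (l + 1) - (u ^ (l + 1) - v ^ (l + 1)) := by ring
    rw [Ideal.span_singleton_le_iff_mem]
    refine (congrArg (· ∈ _) hv).mpr (sub_mem (Ideal.mem_sup_right ?_)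
      (Ideal.mem_sup_left (Ideal.mem_span_singleton_self _)))
    rw [pow_succ']
    exact Ideal.mul_mem_mul (Ideal.mem_span_singleton_self _) (Ideal.pow_mem_pow hu _)
  induction N with
  | zero => simpa using base
  | succ N ih =>
    calc Ideal.span {u, v} ^ (N + 1 + (l + 1))
        = Ideal.span {u, v} * Ideal.span {u, v} ^ (N + (l + 1)) := by ring
      _ ≤ Ideal.span {u, v} * (Ideal.span {u ^ (l + 1) - v ^ (l + 1)} ⊔
            Ideal.span {u ^ (N + 1)} * Ideal.span {u, v} ^ l) := Ideal.mul_mono_right ih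
      _ ≤ Ideal.span {u ^ (l + 1) - v ^ (l + 1)} ⊔
            Ideal.span {u ^ (N + 1)} * Ideal.span {u, v} ^ (l + 1) := by
          rw [Ideal.mul_sup, mul_left_comm, ← pow_succ']
          exact sup_le_sup_right Ideal.mul_le_right _
      _ ≤ Ideal.span {u ^ (l + 1) - v ^ (l + 1)} ⊔ Ideal.span {u ^ (N + 1)} *
            (Ideal.span {u ^ (l + 1) - v ^ (l + 1)} ⊔
              Ideal.span {u} * Ideal.span {u, v} ^ l) :=
          sup_le_sup_left (Ideal.mul_mono_right base) _
      _ ≤ _ := by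
          rw [Ideal.mul_sup, ← mul_assoc, Ideal.span_singleton_mul_span_singleton (u ^ (N + 1)) u,
            ← pow_succ, ← sup_assoc]
          exact sup_le_sup_right (sup_le le_rfl Ideal.mul_le_right) _

theorem pow_sub_pow_mem_span_pair_pow (u v : R) (n : ℕ) :
    u ^ n - v ^ n ∈ Ideal.span {u, v} ^ n :=
  sub_mem (Ideal.pow_mem_pow (Ideal.subset_span (by simp)) _)
    (Ideal.pow_mem_pow (Ideal.subset_span (by simp)) _)

end SpanPair

section Order

variable {σ : Type*} {K : Type*} [Field K]

/-- Membership in a power of `(X p, X q)` in terms of the order of vanishing. -/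
theorem mem_span_X_pair_pow_iff {p q : σ} [DecidableEq σ] (hpq : p ≠ q) (N : ℕ)
    (F : MvPolynomial σ K) :
    F ∈ Ideal.span {X p, X q} ^ N ↔ (N : ℕ∞) ≤
      (F : MvPowerSeries σ K).weightedOrder (fun j => if j = p ∨ j = q then 1 else 0) := by
  set w : σ → ℕ := fun j => if j = p ∨ j = q then 1 else 0 with hw
  constructor
  · let J : ℕ → Ideal (MvPolynomial σ K) := fun M =>
      { carrier := {G | (M : ℕ∞) ≤ (G : MvPowerSeries σ K).weightedOrder w}
        zero_mem' := by simp
        add_mem' := fun {a b} ha hb => by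
          rw [Set.mem_ofPred_eq, coe_add]
          exact (le_min ha hb).trans (MvPowerSeries.min_weightedOrder_le_add w)
        smul_mem' := fun c a ha => by
          rw [Set.mem_ofPred_eq, smul_eq_mul, coe_mul]
          exact (ha.trans le_add_self).trans (MvPowerSeries.le_weightedOrder_mul w) }
    have hJ : ∀ M, Ideal.span {X p, X q} ^ M ≤ J M := by
      intro M
      induction M with
      | zero => intro G _; change ((0 : ℕ) : ℕ∞) ≤ _; simp
      | succ M ih =>
        rw [pow_succ']
        refine Ideal.mul_le.2 fun a ha b hb => ?_
        have h1 : Ideal.span {X p, X q} ≤ J 1 := by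
          rw [Ideal.span_le]
          rintro _ (rfl | rfl)
          all_goals
            change ((1 : ℕ) : ℕ∞) ≤ _
            rw [coe_X, MvPowerSeries.X, MvPowerSeries.weightedOrder_monomial_of_ne_zero _ one_ne_zero]
            simp [hw, Finsupp.weight_single]
        have ha' : ((1 : ℕ) : ℕ∞) ≤ (a : MvPowerSeries σ K).weightedOrder w := h1 ha
        have hb' : (M : ℕ∞) ≤ (b : MvPowerSeries σ K).weightedOrder w := ih hb
        change ((M + 1 : ℕ) : ℕ∞) ≤ ((a * b : MvPolynomial σ K) : MvPowerSeries σ K).weightedOrder w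
        rw [coe_mul, add_comm, Nat.cast_add]
        exact (add_le_add ha' hb').trans (MvPowerSeries.le_weightedOrder_mul w)
    exact fun h => hJ N h
  · intro h
    rw [F.as_sum]
    refine Ideal.sum_mem _ fun d hd => ?_
    have hd' : N ≤ d p + d q := by
      have h1 := h.trans (MvPowerSeries.weightedOrder_le w (d := d)
        (by rwa [coeff_coe, ← mem_support_iff]))
      have h2 : Finsupp.weight w d = d p + d q := by
        rw [Finsupp.weight_apply, Finsupp.sum_of_support_subset (s := d.support ∪ {p, q}) _
          Finset.subset_union_left _ (by simp)]
        rw [← Finset.sum_subset (s₁ := {p, q}) Finset.subset_union_right]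
        · rw [Finset.sum_pair hpq]; simp [hw]
        · intro j _ hj
          have : ¬ (j = p ∨ j = q) := by simpa using hj
          simp [hw, this]
      rw [h2] at h1
      exact_mod_cast h1
    have hle : Finsupp.single p (d p) + Finsupp.single q (d q) ≤ d := by
      intro j
      by_cases h1 : j = p
      · subst h1; simp [hpq.symm]
      · by_cases h2 : j = q
        · subst h2; simp [hpq]
        · simp [Ne.symm h1, Ne.symm h2]
    obtain ⟨e, he⟩ := exists_add_of_le hle
    have hmon : monomial d (coeff d F) = X p ^ d p * X q ^ d q * monomial e (coeff d F) := by
      rw [X_pow_eq_monomial, X_pow_eq_monomial, monomial_mul, monomial_mul, ← he]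
      simp
    rw [hmon]
    refine Ideal.mul_mem_right _ _ (Ideal.pow_le_pow_right hd' ?_)
    rw [pow_add]
    exact Ideal.mul_mem_mul (Ideal.pow_mem_pow (Ideal.subset_span (by simp)) _)
      (Ideal.pow_mem_pow (Ideal.subset_span (by simp)) _)

theorem mem_span_X_pair_pow_of_mul_mem {p q : σ} [DecidableEq σ] (hpq : p ≠ q) {N n : ℕ} {j : σ}
    {F A : MvPolynomial σ K} (hF : coeff (Finsupp.single j n) F ≠ 0)
    (h : F * A ∈ Ideal.span {X p, X q} ^ (N + if j = p ∨ j = q then n else 0)) :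
    A ∈ Ideal.span {X p, X q} ^ N := by
  rw [mem_span_X_pair_pow_iff hpq] at h ⊢
  set w : σ → ℕ := fun j => if j = p ∨ j = q then 1 else 0 with hw
  rw [coe_mul, MvPowerSeries.weightedOrder_mul] at h
  have h1 : (F : MvPowerSeries σ K).weightedOrder w ≤ ((if j = p ∨ j = q then n else 0 : ℕ) : ℕ∞) := by
    refine (MvPowerSeries.weightedOrder_le w (d := Finsupp.single j n) (by rwa [coeff_coe])).trans ?_
    simp [hw, Finsupp.weight_single]
  rw [Nat.cast_add, add_comm] at h
  exact (ENat.add_le_add_iff_left (ENat.natCast_ne_top _)).1 (h.trans (add_le_add_left h1 _))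

end Order

section Fermat

variable {K : Type*} [Field K] {p q r : Fin 3} {l : ℕ}

theorem coeff_single_X_pow_sub (hpq : p ≠ q) :
    coeff (Finsupp.single p (l + 1)) (X p ^ (l + 1) - X q ^ (l + 1) : MvPolynomial (Fin 3) K) ≠ 0 ∧
    coeff (Finsupp.single q (l + 1)) (X p ^ (l + 1) - X q ^ (l + 1) : MvPolynomial (Fin 3) K) ≠ 0 := by
  have h1 := (Finsupp.single_left_injective l.succ_ne_zero).ne hpq
  simp only [coeff_sub, coeff_X_pow, if_true, if_neg h1, if_neg h1.symm]
  simp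

theorem X_pow_sub_X_pow_ne_zero (hpq : p ≠ q) :
    (X p ^ (l + 1) - X q ^ (l + 1) : MvPolynomial (Fin 3) K) ≠ 0 := fun h =>
  (coeff_single_X_pow_sub (K := K) (l := l) hpq).1 (by simp [h])

theorem degreeOf_eq_zero_of_dvd_X_pow_sub {d : MvPolynomial (Fin 3) K} (hpq : p ≠ q)
    (hpr : p ≠ r) (hqr : q ≠ r) (hd : d ∣ X p ^ (l + 1) - X q ^ (l + 1)) : d.degreeOf r = 0 := by
  obtain ⟨e, he⟩ := hd
  have h0 := X_pow_sub_X_pow_ne_zero (K := K) (l := l) hpq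
  rw [he] at h0
  have h1 := degreeOf_sub_le r (X p ^ (l + 1) : MvPolynomial (Fin 3) K) (X q ^ (l + 1))
  rw [he, degreeOf_mul_eq (left_ne_zero_of_mul h0) (right_ne_zero_of_mul h0),
    degreeOf_X_pow_of_ne _ hpr.symm, degreeOf_X_pow_of_ne _ hqr.symm] at h1
  simp at h1
  exact h1.1

theorem isRelPrime_X_pow_sub (hpq : p ≠ q) (hpr : p ≠ r) (hqr : q ≠ r) :
    IsRelPrime (X p ^ (l + 1) - X q ^ (l + 1) : MvPolynomial (Fin 3) K)
      (X r ^ (l + 1) - X p ^ (l + 1)) := by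
  intro d h1 h2
  have h3 : d ∣ X q ^ (l + 1) - X r ^ (l + 1) := by
    have := (dvd_add h1 h2).neg_right
    convert this using 1; ring
  have hr := degreeOf_eq_zero_of_dvd_X_pow_sub hpq hpr hqr h1
  have hq := degreeOf_eq_zero_of_dvd_X_pow_sub hpr.symm hqr.symm hpq h2
  have hp := degreeOf_eq_zero_of_dvd_X_pow_sub hqr hpq.symm hpr.symm h3
  have hall : ∀ j, d.degreeOf j = 0 := by
    intro j
    have : j = p ∨ j = q ∨ j = r := by lia
    rcases this with rfl | rfl | rfl <;> assumption
  have hC : d = C (coeff 0 d) := by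
    rw [← totalDegree_eq_zero_iff_eq_C, totalDegree_eq_zero_iff]
    intro m hm j
    have := monomial_le_degreeOf j hm
    rw [hall j] at this
    exact Nat.le_zero.1 this
  have hne : d ≠ 0 := ne_zero_of_dvd_ne_zero (X_pow_sub_X_pow_ne_zero hpq) h1
  rw [hC]
  refine IsUnit.map C (isUnit_iff_ne_zero.2 fun h => hne ?_)
  rw [hC, h, map_zero]

theorem X_dvd_sub_aeval (r : Fin 3) (A : MvPolynomial (Fin 3) K) :
    X r ∣ A - aeval (fun j => if j = r then 0 else X j : Fin 3 → MvPolynomial (Fin 3) K) A := by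
  induction A using MvPolynomial.induction_on with
  | C a => simp
  | add A B hA hB => rw [map_add, add_sub_add_comm]; exact dvd_add hA hB
  | mul_X A j hA =>
    rw [map_mul, aeval_X]
    split_ifs with h
    · subst h; simp
    · rw [← sub_mul]; exact hA.mul_right _

theorem mem_of_X_mul_mem (hpq : p ≠ q) (hpr : p ≠ r) (hqr : q ≠ r) {N : ℕ}
    {E : MvPolynomial (Fin 3) K}
    (h : X r * E ∈ Ideal.span {X p ^ (l + 1) - X q ^ (l + 1)} ⊔ Ideal.span {X p, X q} ^ N) :
    E ∈ Ideal.span {X p ^ (l + 1) - X q ^ (l + 1)} ⊔ Ideal.span {X p, X q} ^ N := by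
  set φ := aeval (R := K)
    (fun j => if j = r then 0 else X j : Fin 3 → MvPolynomial (Fin 3) K) with hφ
  obtain ⟨s, hs, B, hB, hE⟩ := Submodule.mem_sup.1 h
  obtain ⟨A, rfl⟩ := Ideal.mem_span_singleton.1 hs
  have hφB : φ B ∈ Ideal.span {X p, X q} ^ N := by
    have := Ideal.mem_map_of_mem φ hB
    rwa [Ideal.map_pow, Ideal.map_span, Set.image_pair, hφ, aeval_X, aeval_X, if_neg hpr,
      if_neg hqr] at this
  have h0 : (X p ^ (l + 1) - X q ^ (l + 1)) * φ A + φ B = 0 := by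
    have := congrArg φ hE
    simpa [hφ, hpr, hqr] using this
  obtain ⟨A', hA'⟩ := X_dvd_sub_aeval r A
  obtain ⟨B', hB'⟩ := X_dvd_sub_aeval r B
  rw [← hφ] at hA' hB'
  have hB'mem : B' ∈ Ideal.span {X p, X q} ^ N := by
    refine mem_span_X_pair_pow_of_mul_mem hpq (n := 1) (j := r) (F := (X r : MvPolynomial (Fin 3) K)) ?_ ?_
    · simp [coeff_X]
    · rw [if_neg (by simp [hpr.symm, hqr.symm]), add_zero, ← hB']
      exact sub_mem hB hφB
  have hEeq : E = (X p ^ (l + 1) - X q ^ (l + 1)) * A' + B' := by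
    refine mul_left_cancel₀ (X_ne_zero r : (X r : MvPolynomial (Fin 3) K) ≠ 0) ?_
    linear_combination -hE + (X p ^ (l + 1) - X q ^ (l + 1)) * hA' + hB' + h0
  rw [hEeq]
  exact add_mem (Ideal.mem_sup_left (Ideal.mul_mem_right _ _ (Ideal.mem_span_singleton_self _)))
    (Ideal.mem_sup_right hB'mem)

theorem mem_of_pow_mul_mem (hpq : p ≠ q) (hpr : p ≠ r) (hqr : q ≠ r) {M N : ℕ}
    {E : MvPolynomial (Fin 3) K}
    (h : (X r ^ (l + 1) - X p ^ (l + 1)) ^ M * E ∈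
      Ideal.span {X p ^ (l + 1) - X q ^ (l + 1)} ⊔ Ideal.span {X p, X q} ^ N) :
    E ∈ Ideal.span {X p ^ (l + 1) - X q ^ (l + 1)} ⊔ Ideal.span {X p, X q} ^ N := by
  set Q : Ideal (MvPolynomial (Fin 3) K) := Ideal.span {X p ^ (l + 1) - X q ^ (l + 1)} ⊔
    Ideal.span {X p, X q} ^ N
  have hX : ∀ k, X r ^ k * E ∈ Q → E ∈ Q := by
    intro k
    induction k with
    | zero => simp
    | succ k ih =>
      intro hk
      rw [pow_succ', mul_assoc] at hk
      exact ih (mem_of_X_mul_mem hpq hpr hqr hk)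
  set c : MvPolynomial (Fin 3) K := X r ^ (l + 1)
  set G : MvPolynomial (Fin 3) K := c - X p ^ (l + 1) with hG
  have hcG : c ^ M - G ^ M ∈ Ideal.span {X p, X q} := by
    refine Ideal.mem_of_dvd _ (sub_dvd_pow_sub_pow c G M) ?_
    rw [hG, sub_sub_cancel, pow_succ]
    exact Ideal.mul_mem_left _ _ (Ideal.subset_span (by simp))
  have hmem : (c ^ M - G ^ M) ^ N ∈ Q := Ideal.mem_sup_right (Ideal.pow_mem_pow hcG N)
  obtain ⟨t, ht⟩ := sub_dvd_pow_sub_pow (c ^ M) (c ^ M - G ^ M) N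
  refine hX ((l + 1) * (M * N)) ?_
  have : X r ^ ((l + 1) * (M * N)) * E = (c ^ M - G ^ M) ^ N * E + t * (G ^ M * E) := by
    rw [pow_mul, pow_mul]
    linear_combination E * ht
  rw [this]
  exact add_mem (Ideal.mul_mem_right _ _ hmem) (Ideal.mul_mem_left _ _ h)

/-- One step of the recursion, up to a cyclic permutation of the variables. -/
theorem fermat_recursion_step (hpq : p ≠ q) (hpr : p ≠ r) (hqr : q ≠ r) {N α β m s t : ℕ}
    (hm : α + β = m + 1) (hs : s ≤ (l + 1) * α) (ht : t ≤ (l + 1) * β)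
    {F G H : MvPolynomial (Fin 3) K} (hF : F = X q ^ (l + 1) - X r ^ (l + 1))
    (hG : G = X r ^ (l + 1) - X p ^ (l + 1)) (hH : H = X p ^ (l + 1) - X q ^ (l + 1)) :
    Ideal.span {H, G} ^ (m + 1) ⊓ Ideal.span {X p, X q} ^ (N + (l + 1)) ⊓
        Ideal.span {X q, X r} ^ s ⊓ Ideal.span {X r, X p} ^ t =
      Ideal.span {H} * (Ideal.span {H, G} ^ m ⊓ Ideal.span {X p, X q} ^ N ⊓
        Ideal.span {X q, X r} ^ s ⊓ Ideal.span {X r, X p} ^ t) +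
      Ideal.span {F ^ α * G ^ β * X p ^ (N + 1)} * Ideal.span {X p, X q} ^ l := by
  have hFGH : F = -H - G := by rw [hF, hG, hH]; ring
  have hHmem : H ∈ Ideal.span {H, G} := Ideal.subset_span (by simp)
  have hGmem : G ∈ Ideal.span {H, G} := Ideal.subset_span (by simp)
  have hFmem : F ∈ Ideal.span {H, G} := hFGH ▸ sub_mem (neg_mem hHmem) hGmem
  have hHpq : H ∈ Ideal.span {X p, X q} ^ (l + 1) := hH ▸ pow_sub_pow_mem_span_pair_pow _ _ _
  have hgen : Ideal.span {F ^ α * G ^ β * X p ^ (N + 1)} * Ideal.span {X p, X q} ^ l ≤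
      Ideal.span {H, G} ^ (m + 1) ⊓ Ideal.span {X p, X q} ^ (N + (l + 1)) ⊓
        Ideal.span {X q, X r} ^ s ⊓ Ideal.span {X r, X p} ^ t := by
    refine le_inf (le_inf (le_inf ?_ ?_) ?_) ?_
    · refine Ideal.mul_le_left.trans ((Ideal.span_singleton_le_iff_mem _).2 ?_)
      rw [← hm, pow_add]
      exact Ideal.mul_mem_right _ _
        (Ideal.mul_mem_mul (Ideal.pow_mem_pow hFmem _) (Ideal.pow_mem_pow hGmem _))
    · rw [show N + (l + 1) = (N + 1) + l by ring, pow_add _ (N + 1)]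
      refine Ideal.mul_mono_left ((Ideal.span_singleton_le_iff_mem _).2 ?_)
      exact Ideal.mul_mem_left _ _ (Ideal.pow_mem_pow (Ideal.subset_span (by simp)) _)
    · refine Ideal.mul_le_left.trans ((Ideal.span_singleton_le_iff_mem _).2 ?_)
      refine Ideal.mul_mem_right _ _ (Ideal.mul_mem_right _ _ (Ideal.pow_le_pow_right hs ?_))
      rw [pow_mul, hF]
      exact Ideal.pow_mem_pow (pow_sub_pow_mem_span_pair_pow _ _ _) _
    · refine Ideal.mul_le_left.trans ((Ideal.span_singleton_le_iff_mem _).2 ?_)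
      refine Ideal.mul_mem_right _ _ (Ideal.mul_mem_left _ _ (Ideal.pow_le_pow_right ht ?_))
      rw [pow_mul, hG]
      exact Ideal.pow_mem_pow (pow_sub_pow_mem_span_pair_pow _ _ _) _
  refine le_antisymm (fun D hD => ?_) (sup_le ?_ hgen)
  · obtain ⟨A, -, E, hDE⟩ := exists_of_mem_span_pair_pow_succ hD.1.1.1
    have hE : E ∈ Ideal.span {H} ⊔ Ideal.span {X p, X q} ^ (N + (l + 1)) := by
      rw [hH]
      refine mem_of_pow_mul_mem hpq hpr hqr (M := m + 1) ?_
      rw [← hH, ← hG, show G ^ (m + 1) * E = H * (-A) + D by rw [hDE]; ring]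
      exact add_mem (Ideal.mem_sup_left (Ideal.mul_mem_right _ _ (Ideal.mem_span_singleton_self _)))
        (Ideal.mem_sup_right hD.1.1.2)
    have hE' : E ∈ Ideal.span {H} ⊔
        Ideal.span {X p ^ (N + 1)} * Ideal.span {X p, X q} ^ l := by
      refine (sup_le le_sup_left ?_ : _ ≤ Ideal.span {H} ⊔ _) hE
      rw [hH]
      exact span_pair_pow_add_le _ _ _ _
    obtain ⟨e, he, e', he', rfl⟩ := Submodule.mem_sup.1 hE'
    obtain ⟨E₁, rfl⟩ := Ideal.mem_span_singleton.1 he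
    obtain ⟨E₂, hE₂, rfl⟩ := Ideal.mem_span_singleton_mul.1 he'
    obtain ⟨B, hB⟩ : H ∣ F ^ α - (-G) ^ α :=
      dvd_trans ⟨-1, by rw [hFGH]; ring⟩ (sub_dvd_pow_sub_pow F (-G) α)
    set T := F ^ α * G ^ β * X p ^ (N + 1) * ((-1) ^ α * E₂) with hT
    have hTmem : T ∈ Ideal.span {F ^ α * G ^ β * X p ^ (N + 1)} * Ideal.span {X p, X q} ^ l :=
      Ideal.mul_mem_mul (Ideal.mem_span_singleton_self _) (Ideal.mul_mem_left _ _ hE₂)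
    obtain ⟨A', hA'⟩ : ∃ A', D = H * A' + T := by
      refine ⟨A + G ^ (m + 1) * E₁ - B * G ^ β * X p ^ (N + 1) * ((-1) ^ α * E₂), ?_⟩
      have h1 : ((-1 : MvPolynomial (Fin 3) K) ^ α) * (-1) ^ α = 1 := by
        rw [← mul_pow]; simp
      have h2 : F ^ α = H * B + (-1) ^ α * G ^ α := by
        rw [← mul_pow, neg_one_mul, ← hB]; ring
      rw [hDE, hT, h2, ← hm, pow_add]
      linear_combination (-G ^ α * G ^ β * X p ^ (N + 1) * E₂) * h1
    have hHA : H * A' ∈ Ideal.span {H, G} ^ (m + 1) ⊓ Ideal.span {X p, X q} ^ (N + (l + 1)) ⊓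
        Ideal.span {X q, X r} ^ s ⊓ Ideal.span {X r, X p} ^ t := by
      rw [show H * A' = D - T by rw [hA']; ring]
      exact sub_mem hD (hgen hTmem)
    have hcoeff := coeff_single_X_pow_sub (K := K) (l := l) hpq
    rw [← hH] at hcoeff
    rw [hA']
    refine Submodule.add_mem_sup (Ideal.mul_mem_mul (Ideal.mem_span_singleton_self _) ?_) hTmem
    refine ⟨⟨⟨?_, ?_⟩, ?_⟩, ?_⟩
    · refine mem_span_pair_pow_of_mul_mem (hH ▸ X_pow_sub_X_pow_ne_zero hpq) (fun e he => ?_)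
        hHA.1.1.1
      rw [hH, hG] at he
      rw [hH]
      exact ((isRelPrime_X_pow_sub hpq hpr hqr).pow_right).dvd_of_dvd_mul_left he
    · exact mem_span_X_pair_pow_of_mul_mem hpq hcoeff.1 (by simpa using hHA.1.1.2)
    · exact mem_span_X_pair_pow_of_mul_mem hqr hcoeff.1 (by simpa [hpq, hpr] using hHA.1.2)
    · exact mem_span_X_pair_pow_of_mul_mem hpr.symm hcoeff.2
        (by simpa [hpq.symm, hqr] using hHA.2)
  · refine Ideal.mul_le.2 fun a ha b hb => ?_
    obtain ⟨c, rfl⟩ := Ideal.mem_span_singleton.1 ha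
    rw [mul_assoc, mul_left_comm]
    refine Ideal.mul_mem_left _ c ⟨⟨⟨?_, ?_⟩, Ideal.mul_mem_left _ _ hb.1.2⟩,
      Ideal.mul_mem_left _ _ hb.2⟩
    · rw [pow_succ']; exact Ideal.mul_mem_mul hHmem hb.1.1.1
    · rw [add_comm, pow_add]; exact Ideal.mul_mem_mul hHpq hb.1.1.2

theorem span_pair_eq_span_pair_of_add_eq_zero {R : Type*} [CommRing R] {a b c : R}
    (h : a + b + c = 0) : Ideal.span {a, b} = Ideal.span {c, b} := by
  have hc : c = -a - b := by linear_combination h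
  have ha : a = -c - b := by linear_combination h
  refine le_antisymm (Ideal.span_le.2 ?_) (Ideal.span_le.2 ?_) <;> rintro _ (rfl | rfl)
  · rw [ha]
    exact sub_mem (neg_mem (Ideal.subset_span (by simp))) (Ideal.subset_span (by simp))
  · exact Ideal.subset_span (by simp)
  · rw [hc]
    exact sub_mem (neg_mem (Ideal.subset_span (by simp))) (Ideal.subset_span (by simp))
  · exact Ideal.subset_span (by simp)

theorem inf_inf_inf_rotate {L : Type*} [SemilatticeInf L] (a b c d : L) :
    a ⊓ b ⊓ c ⊓ d = a ⊓ c ⊓ d ⊓ b := by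
  rw [inf_right_comm a b c, inf_right_comm (a ⊓ c) b d]

theorem pf_add_pg_add_ph (K : Type*) [Field K] (n : ℕ) : pf K n + pg K n + ph K n = 0 := by
  rw [pf, pg, ph]; ring

theorem Ifg_eq_span_ph_pg (K : Type*) [Field K] (n : ℕ) :
    Ifg K n = Ideal.span {ph K n, pg K n} :=
  span_pair_eq_span_pair_of_add_eq_zero (pf_add_pg_add_ph K n)

theorem Ifg_eq_span_pf_ph (K : Type*) [Field K] (n : ℕ) :
    Ifg K n = Ideal.span {pf K n, ph K n} := by
  rw [Ifg, Set.pair_comm, Set.pair_comm (pf K n)]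
  exact span_pair_eq_span_pair_of_add_eq_zero
    (by rw [add_comm (pg K n)]; exact pf_add_pg_add_ph K n)

theorem Ifg_eq_span_pg_pf (K : Type*) [Field K] (n : ℕ) :
    Ifg K n = Ideal.span {pg K n, pf K n} := Ifg.eq_1 K n ▸ by rw [Set.pair_comm]

end Fermat

/-- the recursion for the ideals `J_m` interpolating between the symbolic
powers of the Fermat ideal (Theorem 3.8(1) of the paper). Here, for `0 ≤ i ≤ k−1`,
`J_{3i} = (f,g)^{k(n−3)+3i} ∩ (x,y)^{in} ∩ (y,z)^{in} ∩ (x,z)^{in}` (which for `i = 0`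
is `J_0 = (f,g)^{k(n−3)}` since the other factors are the unit ideal), and similarly for
`J_{3i+1}, J_{3i+2}, J_{3i+3}` as in the statement; all ideals are written out
explicitly. -/
theorem fermat_symbolic_recursion {K : Type*} [Field K] (n k : ℕ) (hn : 3 ≤ n) (hk : 1 ≤ k)
    (hζ : ∃ ζ : K, IsPrimitiveRoot ζ n) (hinv : IsUnit (n : K)) :
    ∀ i : ℕ, i ≤ k - 1 →
      (Ifg K n ^ (k * (n - 3) + 3 * i + 1) ⊓ Ixy K ^ ((i + 1) * n) ⊓ Iyz K ^ (i * n) ⊓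
          Izx K ^ (i * n) =
        Ideal.span {ph K n} *
            (Ifg K n ^ (k * (n - 3) + 3 * i) ⊓ Ixy K ^ (i * n) ⊓ Iyz K ^ (i * n) ⊓
              Izx K ^ (i * n)) +
          Ideal.span {pf K n ^ ((k - 1 - i) * (n - 3) + 2 * i + 1) *
            pg K n ^ ((i + 1) * (n - 2) - 1) * X 0 ^ (i * n + 1)} * Ixy K ^ (n - 1)) ∧
      (Ifg K n ^ (k * (n - 3) + 3 * i + 2) ⊓ Ixy K ^ ((i + 1) * n) ⊓ Iyz K ^ ((i + 1) * n) ⊓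
          Izx K ^ (i * n) =
        Ideal.span {pf K n} *
            (Ifg K n ^ (k * (n - 3) + 3 * i + 1) ⊓ Ixy K ^ ((i + 1) * n) ⊓ Iyz K ^ (i * n) ⊓
              Izx K ^ (i * n)) +
          Ideal.span {pg K n ^ ((k - 1 - i) * (n - 3) + 2 * i + 1) *
            ph K n ^ ((i + 1) * (n - 2)) * X 1 ^ (i * n + 1)} * Iyz K ^ (n - 1)) ∧
      (Ifg K n ^ (k * (n - 3) + 3 * i + 3) ⊓ Ixy K ^ ((i + 1) * n) ⊓ Iyz K ^ ((i + 1) * n) ⊓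
          Izx K ^ ((i + 1) * n) =
        Ideal.span {pg K n} *
            (Ifg K n ^ (k * (n - 3) + 3 * i + 2) ⊓ Ixy K ^ ((i + 1) * n) ⊓
              Iyz K ^ ((i + 1) * n) ⊓ Izx K ^ (i * n)) +
          Ideal.span {pf K n ^ ((i + 1) * (n - 2)) *
            ph K n ^ ((k - 1 - i) * (n - 3) + 2 * i + 2) * X 2 ^ (i * n + 1)} * Izx K ^ (n - 1)) := by
  intro i hi
  obtain ⟨n, rfl⟩ := Nat.exists_eq_add_of_le' hn
  obtain ⟨k, rfl⟩ := Nat.exists_eq_add_of_le' (show i + 1 ≤ k by lia)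
  have hk' : k + (i + 1) - 1 - i = k := by lia
  have hN : (i + 1) * (n + 3) = i * (n + 3) + (n + 2 + 1) := by ring
  have hα₁ : i + 1 ≤ k * n + 2 * i + 1 := by
    have := Nat.zero_le (k * n)
    lia
  have hβ₁ : (i + 1) * (n + 1) - 1 = i * n + i + n := by
    rw [show (i + 1) * (n + 1) = i * n + i + n + 1 by ring, Nat.add_sub_cancel]
  have hle {a b : ℕ} (h : a ≤ b) : a * (n + 3) ≤ (n + 2 + 1) * b := by
    rw [mul_comm]
    exact Nat.mul_le_mul_left _ h
  simp only [hk', Nat.add_sub_cancel, show n + 3 - 2 = n + 1 by lia, show n + 3 - 1 = n + 2 by lia]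
  refine ⟨?_, ?_, ?_⟩
  · rw [Ifg_eq_span_ph_pg, hβ₁, hN]
    exact fermat_recursion_step (p := 0) (q := 1) (r := 2) (l := n + 2) (by decide) (by decide)
      (by decide) (by ring) (hle (by lia)) (hle (by nlinarith)) rfl rfl rfl
  · have key := fermat_recursion_step (K := K) (p := 1) (q := 2) (r := 0) (l := n + 2)
      (N := i * (n + 3)) (α := k * n + 2 * i + 1) (β := (i + 1) * (n + 1))
      (m := (k + (i + 1)) * n + 3 * i + 1) (s := i * (n + 3)) (t := (i + 1) * (n + 3))
      (by decide) (by decide) (by decide) (by ring) (hle (by lia)) (hle (by nlinarith)) rfl rfl rfl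
    rw [← hN] at key
    rw [Ifg_eq_span_pf_ph]
    rw [inf_inf_inf_rotate _ (Ixy K ^ _) (Iyz K ^ _), inf_inf_inf_rotate _ (Ixy K ^ _) (Iyz K ^ _)]
    exact key
  · have key := fermat_recursion_step (K := K) (p := 2) (q := 0) (r := 1) (l := n + 2)
      (N := i * (n + 3)) (α := k * n + 2 * i + 2) (β := (i + 1) * (n + 1))
      (m := (k + (i + 1)) * n + 3 * i + 2) (s := (i + 1) * (n + 3)) (t := (i + 1) * (n + 3))
      (by decide) (by decide) (by decide) (by ring) (hle (by lia)) (hle (by nlinarith)) rfl rfl rfl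
    rw [← hN] at key
    rw [Ifg_eq_span_pg_pf, mul_comm (pf K (n + 3) ^ _)]
    rw [inf_inf_inf_rotate _ (Ixy K ^ _) (Iyz K ^ _), inf_inf_inf_rotate _ (Ixy K ^ _) (Iyz K ^ _),
      inf_inf_inf_rotate _ (Iyz K ^ _) (Izx K ^ _), inf_inf_inf_rotate _ (Iyz K ^ _) (Izx K ^ _)]
    exact key
end
end

section
/- For every integer n ≥ 4, the following equality of ideals of R = K[x,y,z] holds: (f, g)^{n−1} ∩ (x, y)^{n−1} ∩ (y, z)^{n−1} ∩ (x, z)^{n−1} = (fgh)·(f, g)^{n−4} + f^{2} g^{n−3}·(x, y)^{n−1} + g^{2} h^{n−3}·(y, z)^{n−1} + f^{n−3} h^{2}·(z, x)^{n−1}. In particular, this gives the (n−1)-st symbolic power I^{(n−1)} of the Fermat ideal I. -/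
open MvPolynomial

noncomputable section

/-- If `f + g + h = 0`, then forms of degree `k + 3` in `f, g` are spanned, modulo `fgh` times
forms of degree `k`, by `f²gᵏ⁺¹`, `g²hᵏ⁺¹` and `fᵏ⁺¹h²`. -/
theorem exists_eq_of_mem_span_pair_pow {R : Type*} [CommRing R] {f g h : R}
    (e : f + g + h = 0) (k : ℕ) {p : R} (hp : p ∈ Ideal.span {f, g} ^ (k + 3)) :
    ∃ q ∈ Ideal.span {f, g} ^ k, ∃ A B C : R,
      p = f * g * h * q + f ^ 2 * g ^ (k + 1) * A + g ^ 2 * h ^ (k + 1) * B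
        + f ^ (k + 1) * h ^ 2 * C := by
  obtain rfl : h = -f - g := by linear_combination e
  have hf : f ∈ Ideal.span {f, g} := Ideal.subset_span (by simp)
  have hg : g ∈ Ideal.span {f, g} := Ideal.subset_span (by simp)
  have hh : -f - g ∈ Ideal.span {f, g} := sub_mem (neg_mem hf) hg
  induction k generalizing p with
  | zero =>
    have key : Ideal.span {f, g} ^ 3 ≤ Ideal.span {f * g * (-f - g), f ^ 2 * g,
        g ^ 2 * (-f - g), f * (-f - g) ^ 2} := by
      rw [pow_succ, pow_two, Ideal.mul_le]
      intro r hr c hc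
      refine Submodule.mul_induction_on hr ?_ fun x y hx hy => by
        rw [add_mul]; exact add_mem hx hy
      intro a ha b hb
      obtain ⟨a₁, a₂, rfl⟩ := Ideal.mem_span_pair.1 ha
      obtain ⟨b₁, b₂, rfl⟩ := Ideal.mem_span_pair.1 hb
      obtain ⟨c₁, c₂, rfl⟩ := Ideal.mem_span_pair.1 hc
      simp only [Ideal.mem_span_insert, Ideal.mem_span_singleton']
      -- coefficients of the product as a binary cubic form in `f` and `g`
      let s := a₁ * b₁ * c₁
      let t := a₁ * b₁ * c₂ + a₁ * b₂ * c₁ + a₂ * b₁ * c₁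
      let u := a₁ * b₂ * c₂ + a₂ * b₁ * c₂ + a₂ * b₂ * c₁
      let v := a₂ * b₂ * c₂
      refine ⟨s - u + v, _, ⟨t - u + v - s, _, ⟨-v, _, ⟨s, rfl⟩, rfl⟩, rfl⟩, ?_⟩
      simp only [s, t, u, v]
      ring
    have hp' := key hp
    simp only [Ideal.mem_span_insert, Ideal.mem_span_singleton'] at hp'
    obtain ⟨q, _, ⟨A, _, ⟨B, _, ⟨C, rfl⟩, rfl⟩, rfl⟩, rfl⟩ := hp'
    exact ⟨q, by simp, A, B, C, by ring⟩
  | succ k ih =>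
    rw [show k + 1 + 3 = (k + 3) + 1 from rfl, pow_succ] at hp
    refine Submodule.mul_induction_on hp ?_ ?_
    · intro s hs r hr
      obtain ⟨q, hq, A, B, C, rfl⟩ := ih hs
      obtain ⟨a, b, rfl⟩ := Ideal.mem_span_pair.1 hr
      refine ⟨q * (a * f + b * g) + (-(a * A)) * (g ^ k * f) + ((a - b) * B) * ((-f - g) ^ k * g)
          + (b * C) * (f ^ k * (-f - g)), ?_, (b - a) * A, -(b * B), a * C, ?_⟩
      · simp only [pow_succ]
        refine add_mem (add_mem (add_mem (Ideal.mul_mem_mul hq hr) ?_) ?_) ?_ <;>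
          refine Ideal.mul_mem_left _ _ (Ideal.mul_mem_mul (Ideal.pow_mem_pow ?_ k) ?_) <;>
          assumption
      · generalize hH : -f - g = H at *
        have e' : f + g + H = 0 := by rw [← hH]; ring
        linear_combination (a * f ^ 2 * g ^ (k + 1) * A + b * g ^ 2 * H ^ (k + 1) * B) * e'
    · rintro x y ⟨q, hq, A, B, C, rfl⟩ ⟨q', hq', A', B', C', rfl⟩
      exact ⟨q + q', add_mem hq hq', A + A', B + B', C + C', by ring⟩

/-- Powers of an ideal generated by two variables are monomial ideals. -/
theorem span_X_pair_pow {σ K : Type*} [CommSemiring K] (i j : σ) (m : ℕ) :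
    (Ideal.span {X i, X j} : Ideal (MvPolynomial σ K)) ^ m =
      Ideal.span ((fun s => monomial s (1 : K)) ''
        {s | ∃ a b, a + b = m ∧ s = Finsupp.single i a + Finsupp.single j b}) := by
  have hm (a b : ℕ) : (monomial (Finsupp.single i a + Finsupp.single j b) (1 : K)) =
      X i ^ a * X j ^ b := by
    rw [X_pow_eq_monomial, X_pow_eq_monomial, monomial_mul, one_mul]
  apply le_antisymm
  · induction m with
    | zero =>
      rw [pow_zero, Ideal.one_eq_top, top_le_iff, Ideal.eq_top_iff_one]
      exact Ideal.subset_span ⟨0, ⟨0, 0, by simp⟩, rfl⟩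
    | succ m ih =>
      rw [pow_succ]
      refine (Ideal.mul_mono_left ih).trans ?_
      rw [Ideal.span_mul_span', Ideal.span_le]
      rintro _ ⟨_, ⟨_, ⟨a, b, rfl, rfl⟩, rfl⟩, y, rfl | rfl, rfl⟩
      · refine Ideal.subset_span ⟨_, ⟨a + 1, b, by ring, rfl⟩, ?_⟩
        simp only [hm]
        ring
      · refine Ideal.subset_span ⟨_, ⟨a, b + 1, by ring, rfl⟩, ?_⟩
        simp only [hm]
        ring
  · rw [Ideal.span_le]
    rintro _ ⟨_, ⟨a, b, rfl, rfl⟩, rfl⟩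
    simp only [hm, pow_add]
    exact Ideal.mul_mem_mul (Ideal.pow_mem_pow (Ideal.subset_span (by simp)) a)
      (Ideal.pow_mem_pow (Ideal.subset_span (by simp)) b)

/-- A further variable is a nonzerodivisor modulo any power of `(X i, X j)`. -/
theorem mem_span_X_pair_pow_of_X_pow_mul_mem {σ K : Type*} [CommSemiring K] {i j k : σ}
    (hi : i ≠ k) (hj : j ≠ k) {m N : ℕ} {A : MvPolynomial σ K}
    (hA : X k ^ N * A ∈ Ideal.span {X i, X j} ^ m) : A ∈ Ideal.span {X i, X j} ^ m := by
  rw [span_X_pair_pow, mem_ideal_span_monomial_image] at hA ⊢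
  intro d hd
  have hd' : Finsupp.single k N + d ∈ (X k ^ N * A).support := by
    rw [mem_support_iff, X_pow_eq_monomial, coeff_monomial_mul, one_mul]
    exact mem_support_iff.1 hd
  obtain ⟨s, ⟨a, b, hab, rfl⟩, hs⟩ := hA _ hd'
  refine ⟨_, ⟨a, b, hab, rfl⟩, fun l => ?_⟩
  by_cases hl : l = k
  · subst hl
    simp [hi, hj]
  · simpa [Finsupp.single_eq_of_ne hl] using hs l

theorem pow_mul_eq_zero_of_neg_pow_mul_eq_zero {R : Type*} [CommRing R] {c a : R} {n r s : ℕ}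
    (h : (-c ^ n) ^ r * (c ^ n) ^ s * a = 0) : c ^ (n * r + n * s) * a = 0 := by
  have hsq : ((-1) ^ r * (-1) ^ r : R) = 1 := by
    rw [← mul_pow, neg_one_mul, neg_neg, one_pow]
  rw [neg_pow (c ^ n)] at h
  linear_combination (-1) ^ r * h - c ^ (n * r + n * s) * a * hsq

/-- For `m ≤ n`, products of powers of `X jⁿ - X kⁿ` and `X kⁿ - X iⁿ` are nonzerodivisors modulo
`(X i, X j)ᵐ`. -/
theorem mem_span_X_pair_pow_of_mul_mem_s12 {σ K : Type*} [CommRing K] {i j k : σ}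
    (hi : i ≠ k) (hj : j ≠ k) {n m r s : ℕ} (hmn : m ≤ n) {A : MvPolynomial σ K}
    (hA : (X j ^ n - X k ^ n) ^ r * (X k ^ n - X i ^ n) ^ s * A ∈ Ideal.span {X i, X j} ^ m) :
    A ∈ Ideal.span {X i, X j} ^ m := by
  set I : Ideal (MvPolynomial σ K) := Ideal.span {X i, X j} ^ m
  have hXi : (X i : MvPolynomial σ K) ^ n ∈ I :=
    Ideal.pow_le_pow_right hmn (Ideal.pow_mem_pow (Ideal.subset_span (by simp)) n)
  have hXj : (X j : MvPolynomial σ K) ^ n ∈ I :=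
    Ideal.pow_le_pow_right hmn (Ideal.pow_mem_pow (Ideal.subset_span (by simp)) n)
  refine mem_span_X_pair_pow_of_X_pow_mul_mem (N := n * r + n * s) hi hj ?_
  rw [← Ideal.Quotient.eq_zero_iff_mem] at hA hXi hXj ⊢
  simp only [map_mul, map_pow, map_sub] at hA hXi hXj ⊢
  rw [hXi, hXj, zero_sub, sub_zero] at hA
  exact pow_mul_eq_zero_of_neg_pow_mul_eq_zero hA

/-- for `n ≥ 4`,
`(f,g)^{n−1} ∩ (x,y)^{n−1} ∩ (y,z)^{n−1} ∩ (x,z)^{n−1}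
  = (fgh)(f,g)^{n−4} + f²g^{n−3}(x,y)^{n−1} + g²h^{n−3}(y,z)^{n−1} + f^{n−3}h²(z,x)^{n−1}`;
the left-hand side is the `(n−1)`-st symbolic power `I^{(n−1)}` of the Fermat ideal. -/
theorem fermat_symbolic_n_minus_one {K : Type*} [Field K] (n : ℕ) (hn : 4 ≤ n)
    (hζ : ∃ ζ : K, IsPrimitiveRoot ζ n) (hinv : IsUnit (n : K)) :
    symbPow K n (n - 1) =
      Ideal.span {pf K n * pg K n * ph K n} * Ifg K n ^ (n - 4) +
        Ideal.span {pf K n ^ 2 * pg K n ^ (n - 3)} * Ixy K ^ (n - 1) +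
        Ideal.span {pg K n ^ 2 * ph K n ^ (n - 3)} * Iyz K ^ (n - 1) +
        Ideal.span {pf K n ^ (n - 3) * ph K n ^ 2} * Izx K ^ (n - 1) := by
  have e : pf K n + pg K n + ph K n = 0 := by
    simp only [pf, pg, ph]
    ring
  have hsub {i j : Fin 3} {I : Ideal (MvPolynomial (Fin 3) K)} (hi : X i ∈ I) (hj : X j ∈ I) :
      X i ^ n - X j ^ n ∈ I ^ (n - 1) :=
    Ideal.pow_le_pow_right (Nat.sub_le n 1)
      (sub_mem (Ideal.pow_mem_pow hi n) (Ideal.pow_mem_pow hj n))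
  have hf : pf K n ∈ Iyz K ^ (n - 1) :=
    hsub (Ideal.subset_span (by simp)) (Ideal.subset_span (by simp))
  have hg : pg K n ∈ Izx K ^ (n - 1) :=
    hsub (Ideal.subset_span (by simp)) (Ideal.subset_span (by simp))
  have hh : ph K n ∈ Ixy K ^ (n - 1) :=
    hsub (Ideal.subset_span (by simp)) (Ideal.subset_span (by simp))
  have hf₀ : pf K n ∈ Ifg K n := Ideal.subset_span (by simp)
  have hg₀ : pg K n ∈ Ifg K n := Ideal.subset_span (by simp)
  have hh₀ : ph K n ∈ Ifg K n := by
    rw [show ph K n = -pf K n - pg K n by linear_combination e]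
    exact sub_mem (neg_mem hf₀) hg₀
  obtain ⟨k, rfl⟩ := Nat.exists_eq_add_of_le' hn
  rw [show k + 4 - 4 = k by omega, show k + 4 - 3 = k + 1 by omega,
    show k + 4 - 1 = k + 3 by omega] at *
  generalize hF : pf K (k + 4) = f at *
  generalize hG : pg K (k + 4) = g at *
  generalize hH : ph K (k + 4) = h at *
  apply le_antisymm
  · rintro p ⟨⟨⟨hp, hxy⟩, hyz⟩, hzx⟩
    rw [Ifg, hF, hG] at hp
    obtain ⟨q, hq, A, B, C, rfl⟩ := exists_eq_of_mem_span_pair_pow e k hp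
    have hA : A ∈ Ixy K ^ (k + 3) := by
      refine mem_span_X_pair_pow_of_mul_mem_s12 (k := 2) (n := k + 4) (r := 2) (s := k + 1)
        (by decide) (by decide) (by omega) ?_
      rw [← Ixy, ← pf, ← pg, hF, hG]
      convert sub_mem hxy (Ideal.mul_mem_left _
        (f * g * q + g ^ 2 * h ^ k * B + f ^ (k + 1) * h * C) hh) using 2
      ring
    have hB : B ∈ Iyz K ^ (k + 3) := by
      refine mem_span_X_pair_pow_of_mul_mem_s12 (k := 0) (n := k + 4) (r := 2) (s := k + 1)
        (by decide) (by decide) (by omega) ?_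
      rw [← Iyz, ← pg, ← ph, hG, hH]
      convert sub_mem hyz (Ideal.mul_mem_left _
        (g * h * q + f * g ^ (k + 1) * A + f ^ k * h ^ 2 * C) hf) using 2
      ring
    have hC : C ∈ Izx K ^ (k + 3) := by
      refine mem_span_X_pair_pow_of_mul_mem_s12 (k := 1) (n := k + 4) (r := 2) (s := k + 1)
        (by decide) (by decide) (by omega) ?_
      rw [← Izx, ← ph, ← pf, hH, hF]
      convert sub_mem hzx (Ideal.mul_mem_left _
        (f * h * q + f ^ 2 * g ^ k * A + g * h ^ (k + 1) * B) hg) using 2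
      ring
    rw [Ifg, hF, hG]
    refine Submodule.add_mem_sup (Submodule.add_mem_sup (Submodule.add_mem_sup ?_ ?_) ?_) ?_ <;>
      exact Ideal.mul_mem_mul (Ideal.mem_span_singleton_self _) (by assumption)
  · have hpow {a b : MvPolynomial (Fin 3) K} (ha : a ∈ Ifg K (k + 4)) (hb : b ∈ Ifg K (k + 4)) :
        a ^ 2 * b ^ (k + 1) ∈ Ifg K (k + 4) ^ (k + 3) := by
      rw [show k + 3 = 2 + (k + 1) by ring, pow_add]
      exact Ideal.mul_mem_mul (Ideal.pow_mem_pow ha 2) (Ideal.pow_mem_pow hb (k + 1))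
    have hle {a : MvPolynomial (Fin 3) K} {b : ℕ} {I : Ideal (MvPolynomial (Fin 3) K)}
        (ha : a ∈ I ^ (k + 3)) : a ^ (b + 1) ∈ I ^ (k + 3) :=
      Ideal.pow_mem_of_mem _ ha _ b.succ_pos
    refine sup_le (sup_le (sup_le ?_ ?_) ?_) ?_ <;>
      refine Ideal.span_singleton_mul_le_iff.2 fun q hq => ⟨⟨⟨?_, ?_⟩, ?_⟩, ?_⟩
    · rw [show k + 3 = 3 + k by ring, pow_add]
      refine Ideal.mul_mem_mul ?_ hq
      rw [pow_succ, pow_two]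
      exact Ideal.mul_mem_mul (Ideal.mul_mem_mul hf₀ hg₀) hh₀
    · exact Ideal.mul_mem_right _ _ (Ideal.mul_mem_left _ _ hh)
    · exact Ideal.mul_mem_right _ _ (Ideal.mul_mem_right _ _ (Ideal.mul_mem_right _ _ hf))
    · exact Ideal.mul_mem_right _ _ (Ideal.mul_mem_right _ _ (Ideal.mul_mem_left _ _ hg))
    · exact Ideal.mul_mem_right _ _ (hpow hf₀ hg₀)
    · exact Ideal.mul_mem_left _ _ hq
    · exact Ideal.mul_mem_right _ _ (Ideal.mul_mem_right _ _ (hle hf))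
    · exact Ideal.mul_mem_right _ _ (Ideal.mul_mem_left _ _ (hle hg))
    · exact Ideal.mul_mem_right _ _ (hpow hg₀ hh₀)
    · exact Ideal.mul_mem_right _ _ (Ideal.mul_mem_left _ _ (hle hh))
    · exact Ideal.mul_mem_left _ _ hq
    · exact Ideal.mul_mem_right _ _ (Ideal.mul_mem_right _ _ (hle hg))
    · exact Ideal.mul_mem_right _ _ (mul_comm (h ^ 2) _ ▸ hpow hh₀ hf₀)
    · exact Ideal.mul_mem_right _ _ (Ideal.mul_mem_left _ _ (hle hh))
    · exact Ideal.mul_mem_right _ _ (Ideal.mul_mem_right _ _ (hle hf))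
    · exact Ideal.mul_mem_left _ _ hq
end
end

section
/- Let m ≥ 1 be an integer and let τ ∈ R = K[x,y,z] be a homogeneous polynomial belonging to the m-th symbolic power I^{(m)} of the Fermat ideal, with deg(τ) < m(n+1). Then τ is divisible by the product fgh. Consequently, every homogeneous element of I^{(m)} of degree less than m(n+1) lies in the principal ideal (fgh). -/
open MvPolynomial

noncomputable section

lemma span_pair_le_of_add_eq_zero {R : Type*} [CommRing R] {a b c : R} (h : a + b + c = 0) :
    Ideal.span {a, b} ≤ Ideal.span {b, c} := by
  refine Ideal.span_le.2 ?_
  rintro p (rfl | rfl)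
  · exact Ideal.mem_span_pair.2 ⟨-1, -1, by linear_combination -h⟩
  · exact Ideal.subset_span (by simp)

section LinearSubstitution

variable {K σ : Type*} [Field K]

lemma X_pow_sub_X_pow_eq_prod {n : ℕ} (hn : 0 < n) {ζ : K} (hζ : IsPrimitiveRoot ζ n) (j k : σ) :
    (X j ^ n - X k ^ n : MvPolynomial σ K) =
      ∏ ω ∈ Polynomial.nthRootsFinset n (1 : K), (X j - C ω * X k) := by
  have hC : IsPrimitiveRoot (C ζ : MvPolynomial σ K) n := hζ.map_of_injective (C_injective σ K)
  rw [hC.pow_sub_pow_eq_prod_sub_mul _ _ hn]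
  symm
  refine Finset.prod_bij (fun ω _ ↦ C ω) (fun ω h ↦ ?_) (fun _ _ _ _ h ↦ C_injective σ K h)
    (fun u hu ↦ ?_) fun _ _ ↦ rfl
  · rw [Polynomial.mem_nthRootsFinset hn] at h ⊢
    rw [← C_pow, h, C_1]
  · rw [Polynomial.mem_nthRootsFinset hn] at hu
    have : NeZero n := ⟨hn.ne'⟩
    obtain ⟨e, -, rfl⟩ := hC.eq_pow_of_pow_eq_one hu
    refine ⟨ζ ^ e, (Polynomial.mem_nthRootsFinset hn _).2 ?_, C_pow _ _⟩
    rw [← pow_mul, mul_comm, pow_mul, hζ.pow_eq_one, one_pow]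

variable [DecidableEq σ]

/-- The `K`-algebra endomorphism of `K[σ]` sending `X j` to `a • X k` and fixing the other
variables, i.e. restriction to the hyperplane `X j = a • X k`. -/
def substVar (a : K) (j k : σ) : MvPolynomial σ K →ₐ[K] MvPolynomial σ K :=
  aeval (Function.update X j (C a * X k))

lemma substVar_X_self (a : K) (j k : σ) :
    substVar a j k (X j) = C a * X k := by
  simp [substVar]

lemma substVar_X_of_ne (a : K) {i j : σ} (k : σ) (h : i ≠ j) :
    substVar a j k (X i) = X i := by
  simp [substVar, h]

lemma isHomogeneous_substVar (a : K) (j k : σ) {p : MvPolynomial σ K} {d : ℕ}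
    (hp : p.IsHomogeneous d) : (substVar a j k p).IsHomogeneous d := by
  have := hp.aeval (n := 1) (Function.update X j (C a * X k)) fun i ↦ by
    rcases eq_or_ne i j with rfl | h
    · simpa using (isHomogeneous_C σ a).mul (isHomogeneous_X K k)
    · simpa [h] using isHomogeneous_X K i
  simpa [substVar] using this

lemma sub_substVar_mem (a : K) (j k : σ) (p : MvPolynomial σ K) :
    p - substVar a j k p ∈ Ideal.span {(X j - C a * X k : MvPolynomial σ K)} := by
  rw [← Ideal.Quotient.mk_eq_mk_iff_sub_mem]
  suffices h : Ideal.Quotient.mkₐ K (Ideal.span {(X j - C a * X k : MvPolynomial σ K)}) =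
      (Ideal.Quotient.mkₐ K _).comp (substVar a j k) from DFunLike.congr_fun h p
  ext i
  rcases eq_or_ne i j with rfl | h
  · simp only [AlgHom.comp_apply, substVar_X_self, Ideal.Quotient.mkₐ_eq_mk]
    exact (Ideal.Quotient.mk_eq_mk_iff_sub_mem _ _).2 (Ideal.mem_span_singleton_self _)
  · simp only [AlgHom.comp_apply, substVar_X_of_ne a k h]

lemma linear_dvd_iff (a : K) {j k : σ} (hjk : j ≠ k) (p : MvPolynomial σ K) :
    X j - C a * X k ∣ p ↔ substVar a j k p = 0 := by
  constructor
  · rintro ⟨q, rfl⟩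
    simp [substVar, hjk.symm]
  · intro h
    simpa [h, Ideal.mem_span_singleton] using sub_substVar_mem a j k p

lemma prime_linear (a : K) {j k : σ} (hjk : j ≠ k) :
    Prime (X j - C a * X k : MvPolynomial σ K) := by
  refine ⟨fun h ↦ ?_, fun h ↦ ?_, fun p q h ↦ ?_⟩
  · have := (linear_dvd_iff (a + 1) hjk (X j - C a * X k)).1 (h ▸ dvd_zero _)
    simp [substVar, hjk.symm, add_mul] at this
  · simpa using (linear_dvd_iff a hjk 1).1 h.dvd
  · simpa [linear_dvd_iff a hjk] using h

lemma isRelPrime_linear (a : K) {j k : σ} (hjk : j ≠ k) {p : MvPolynomial σ K}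
    (hp : substVar a j k p ≠ 0) : IsRelPrime (X j - C a * X k) p :=
  (prime_linear a hjk).irreducible.isRelPrime_iff_not_dvd.2 (mt (linear_dvd_iff a hjk p).1 hp)

lemma X_pow_sub_X_pow_ne_zero_s13 {i k : σ} (hik : i ≠ k) {n : ℕ} (hn : n ≠ 0) :
    (X k ^ n - X i ^ n : MvPolynomial σ K) ≠ 0 := by
  intro h
  simpa [substVar, hik.symm, hn] using congrArg (substVar (0 : K) i k) h

/-- If `ω ^ n = 1`, then `X j - ω X k` divides every form of degree less than `m (n + 1)` which
vanishes to order `m` along `X j = X k = 0` and along `X j ^ n = X k ^ n = X i ^ n`. -/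
lemma linear_dvd_of_mem_pow {i j k : σ} (hij : i ≠ j) (hik : i ≠ k) (hjk : j ≠ k)
    {n m d : ℕ} (hn : n ≠ 0) {ω : K} (hω : ω ^ n = 1) {τ : MvPolynomial σ K}
    (hτ : τ.IsHomogeneous d) (hd : d < m * (n + 1))
    (h₁ : τ ∈ Ideal.span {(X j ^ n - X k ^ n : MvPolynomial σ K), X k ^ n - X i ^ n} ^ m)
    (h₂ : τ ∈ Ideal.span {(X j : MvPolynomial σ K), X k} ^ m) :
    X j - C ω * X k ∣ τ := by
  rw [linear_dvd_iff ω hjk]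
  have hωC : (C ω : MvPolynomial σ K) ^ n = 1 := by rw [← C_pow, hω, C_1]
  have key : ∀ {u v w : MvPolynomial σ K}, τ ∈ Ideal.span {u, v} ^ m →
      w ∣ substVar ω j k u → w ∣ substVar ω j k v → w ^ m ∣ substVar ω j k τ := by
    intro u v w h hu hv
    rw [← Ideal.mem_span_singleton, ← Ideal.span_singleton_pow]
    have := Ideal.mem_map_of_mem (substVar ω j k) h
    rw [Ideal.map_pow, Ideal.map_span, Set.image_pair] at this
    refine Ideal.pow_right_mono (Ideal.span_le.2 ?_) m this
    rintro p (rfl | rfl)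
    · exact Ideal.mem_span_singleton.2 hu
    · exact Ideal.mem_span_singleton.2 hv
  have hX := key (w := X k) h₂ (by simp [substVar_X_self])
    (by simp [substVar_X_of_ne ω k hjk.symm])
  have hXn := key (w := X k ^ n - X i ^ n) h₁
    (by simp [substVar_X_self, substVar_X_of_ne ω k hjk.symm, mul_pow, hωC])
    (by simp [substVar_X_of_ne ω k hjk.symm, substVar_X_of_ne ω k hij])
  have hrel : IsRelPrime (X k : MvPolynomial σ K) (X k ^ n - X i ^ n) := by
    have := isRelPrime_linear (0 : K) hik.symm (p := X k ^ n - X i ^ n)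
      (by simp [substVar, hik, hn])
    simpa using this
  by_contra h0
  have hdvd := (hrel.pow (m := m) (n := m)).mul_dvd hX hXn
  have hne := X_pow_sub_X_pow_ne_zero_s13 (K := K) hik hn
  have hdeg : ((X k ^ n - X i ^ n : MvPolynomial σ K) ^ m).totalDegree = n * m :=
    (((isHomogeneous_X_pow k n).sub (isHomogeneous_X_pow i n)).pow m).totalDegree (pow_ne_zero m hne)
  have hle := totalDegree_le_of_dvd_of_isDomain hdvd h0
  rw [totalDegree_mul_of_isDomain (pow_ne_zero _ (X_ne_zero k)) (pow_ne_zero _ hne),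
    totalDegree_X_pow, hdeg,
    (isHomogeneous_substVar ω j k hτ).totalDegree h0] at hle
  linarith

lemma X_pow_sub_X_pow_dvd_of_mem_pow {i j k : σ} (hij : i ≠ j) (hik : i ≠ k) (hjk : j ≠ k)
    {n m d : ℕ} (hn : 0 < n) {ζ : K} (hζ : IsPrimitiveRoot ζ n) {τ : MvPolynomial σ K}
    (hτ : τ.IsHomogeneous d) (hd : d < m * (n + 1))
    (h₁ : τ ∈ Ideal.span {(X j ^ n - X k ^ n : MvPolynomial σ K), X k ^ n - X i ^ n} ^ m)
    (h₂ : τ ∈ Ideal.span {(X j : MvPolynomial σ K), X k} ^ m) :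
    X j ^ n - X k ^ n ∣ τ := by
  rw [X_pow_sub_X_pow_eq_prod hn hζ]
  refine Finset.prod_dvd_of_isRelPrime (fun a _ b _ hab ↦ ?_) fun ω hω ↦
    linear_dvd_of_mem_pow hij hik hjk hn.ne' ((Polynomial.mem_nthRootsFinset hn _).1 hω) hτ hd h₁ h₂
  refine isRelPrime_linear a hjk ?_
  rw [map_sub, map_mul, substVar_X_self, substVar_X_of_ne a k hjk.symm, algHom_C,
    algebraMap_eq, ← sub_mul, ← C_sub]
  exact mul_ne_zero (C_ne_zero.2 (sub_ne_zero.2 hab)) (X_ne_zero k)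

lemma isRelPrime_X_pow_sub_X_pow {i j k : σ} (hij : i ≠ j) (hik : i ≠ k) (hjk : j ≠ k)
    {n : ℕ} (hn : 0 < n) {ζ : K} (hζ : IsPrimitiveRoot ζ n) :
    IsRelPrime (X j ^ n - X k ^ n : MvPolynomial σ K) (X k ^ n - X i ^ n) := by
  rw [X_pow_sub_X_pow_eq_prod hn hζ j k]
  refine IsRelPrime.prod_left fun ω _ ↦ isRelPrime_linear ω hjk ?_
  simpa [substVar_X_of_ne ω k hjk.symm, substVar_X_of_ne ω k hij] using
    X_pow_sub_X_pow_ne_zero_s13 (K := K) hik hn.ne'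

end LinearSubstitution

/-- every homogeneous element `τ` of the `m`-th symbolic power of the Fermat
ideal with `deg τ < m(n+1)` is divisible by `fgh`; consequently all such elements lie in
the principal ideal `(fgh)`. -/
theorem fermat_low_degree_divisible {K : Type*} [Field K] (n : ℕ) (hn : 3 ≤ n)
    (hζ : ∃ ζ : K, IsPrimitiveRoot ζ n) (hinv : IsUnit (n : K)) (m : ℕ) (hm : 1 ≤ m)
    (τ : MvPolynomial (Fin 3) K) (d : ℕ) (hτ : τ.IsHomogeneous d)
    (hmem : τ ∈ symbPow K n m) (hdeg : d < m * (n + 1)) :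
    (pf K n * pg K n * ph K n) ∣ τ ∧ τ ∈ Ideal.span {pf K n * pg K n * ph K n} := by
  suffices h : pf K n * pg K n * ph K n ∣ τ from ⟨h, Ideal.mem_span_singleton.2 h⟩
  obtain ⟨ζ, hζ⟩ := hζ
  obtain ⟨⟨⟨hfg, hxy⟩, hyz⟩, hzx⟩ := hmem
  have hn0 : 0 < n := by omega
  have hgh : τ ∈ Ideal.span {pg K n, ph K n} ^ m :=
    Ideal.pow_right_mono (span_pair_le_of_add_eq_zero (by simp only [pf, pg, ph]; ring)) m hfg
  have hhf : τ ∈ Ideal.span {ph K n, pf K n} ^ m :=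
    Ideal.pow_right_mono (span_pair_le_of_add_eq_zero (by simp only [pf, pg, ph]; ring)) m hgh
  have hf : pf K n ∣ τ := X_pow_sub_X_pow_dvd_of_mem_pow (i := 0) (by decide) (by decide)
    (by decide) hn0 hζ hτ hdeg hfg hyz
  have hg : pg K n ∣ τ := X_pow_sub_X_pow_dvd_of_mem_pow (i := 1) (by decide) (by decide)
    (by decide) hn0 hζ hτ hdeg hgh hzx
  have hh : ph K n ∣ τ := X_pow_sub_X_pow_dvd_of_mem_pow (i := 2) (by decide) (by decide)
    (by decide) hn0 hζ hτ hdeg hhf hxy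
  have rfg : IsRelPrime (pf K n) (pg K n) :=
    isRelPrime_X_pow_sub_X_pow (by decide) (by decide) (by decide) hn0 hζ
  have rgh : IsRelPrime (pg K n) (ph K n) :=
    isRelPrime_X_pow_sub_X_pow (by decide) (by decide) (by decide) hn0 hζ
  have rhf : IsRelPrime (ph K n) (pf K n) :=
    isRelPrime_X_pow_sub_X_pow (by decide) (by decide) (by decide) hn0 hζ
  exact (rhf.symm.mul_left rgh).mul_dvd (rfg.mul_dvd hf hg) hh
end
end

section
/- For all integers n ≥ 3 and k ≥ 2, the symbolic powers of the Fermat ideal I satisfy I^{(kn)} = I^{(n)} · I^{((k−1)n)} (in particular, the containment I^{(kn)} ⊆ I^{(n)} · I^{((k−1)n)} holds). -/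
open MvPolynomial

noncomputable section

/-- The product `x^A y^B z^C f^D g^E h^F`. -/
def lineProd (K : Type*) [Field K] (n A B C D E F : ℕ) : MvPolynomial (Fin 3) K :=
  X 0 ^ A * X 1 ^ B * X 2 ^ C * pf K n ^ D * pg K n ^ E * ph K n ^ F

/-- Substitution pushing the plane towards the point `(1 : 1 : 1)`. -/
def scaleUnit (K : Type*) [Field K] :
    MvPolynomial (Fin 3) K →ₐ[K] Polynomial (MvPolynomial (Fin 3) K) :=
  aeval ![Polynomial.C (X 2) + Polynomial.X * Polynomial.C (X 0 - X 2),
    Polynomial.C (X 2) + Polynomial.X * Polynomial.C (X 1 - X 2), Polynomial.C (X 2)]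

/-- The substitution multiplying the variable `X i` by `t ^ w i`. -/
def scaleVars (K : Type*) [Field K] (w : Fin 3 → ℕ) :
    MvPolynomial (Fin 3) K →ₐ[K] Polynomial (MvPolynomial (Fin 3) K) :=
  aeval fun i => Polynomial.X ^ w i * Polynomial.C (X i)

/-- `P` vanishes to order `m` at `(1 : 1 : 1)` and to orders `p`, `q`, `r` at the points
`x = y = 0`, `y = z = 0`, `z = x = 0`. -/
structure VanishesTo {K : Type*} [Field K] (m p q r : ℕ) (P : MvPolynomial (Fin 3) K) : Prop where
  unit : Polynomial.X ^ m ∣ scaleUnit K P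
  xy : Polynomial.X ^ p ∣ scaleVars K ![1, 1, 0] P
  yz : Polynomial.X ^ q ∣ scaleVars K ![0, 1, 1] P
  zx : Polynomial.X ^ r ∣ scaleVars K ![1, 0, 1] P

/-- The products of the six lines through pairs of the four points with prescribed vanishing
orders at the points. -/
def lineProds (K : Type*) [Field K] (m p q r : ℕ) : Set (MvPolynomial (Fin 3) K) :=
  {P | ∃ A B C D E F : ℕ, m ≤ D + E + F ∧ p ≤ A + B + F ∧ q ≤ B + C + D ∧ r ≤ C + A + E ∧
    P = lineProd K 1 A B C D E F}

section FourPoints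

variable {K : Type*} [Field K] {m p q r d : ℕ}

theorem VanishesTo.sub {P Q : MvPolynomial (Fin 3) K} (hP : VanishesTo m p q r P)
    (hQ : VanishesTo m p q r Q) : VanishesTo m p q r (P - Q) := by
  constructor <;> rw [map_sub]
  exacts [dvd_sub hP.unit hQ.unit, dvd_sub hP.xy hQ.xy, dvd_sub hP.yz hQ.yz, dvd_sub hP.zx hQ.zx]

theorem vanishesTo_of_mem_span {P : MvPolynomial (Fin 3) K}
    (hP : P ∈ Submodule.span K (lineProds K m p q r)) : VanishesTo m p q r P := by
  induction hP using Submodule.span_induction with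
  | zero => constructor <;> simp
  | add P Q _ _ hP hQ =>
    constructor <;> rw [map_add]
    exacts [dvd_add hP.unit hQ.unit, dvd_add hP.xy hQ.xy, dvd_add hP.yz hQ.yz,
      dvd_add hP.zx hQ.zx]
  | smul c P _ hP =>
    constructor <;> rw [map_smul]
    exacts [dvd_smul_of_dvd _ hP.unit, dvd_smul_of_dvd _ hP.xy, dvd_smul_of_dvd _ hP.yz,
      dvd_smul_of_dvd _ hP.zx]
  | mem P hP =>
    obtain ⟨A, B, C, D, E, F, h1, h2, h3, h4, rfl⟩ := hP
    constructor
    · refine (pow_dvd_pow _ h1).trans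
        ⟨scaleUnit K (X 0 ^ A * X 1 ^ B * X 2 ^ C) * Polynomial.C (lineProd K 1 0 0 0 D E F), ?_⟩
      simp only [lineProd, scaleUnit, pf, pg, ph, map_mul, map_pow, map_sub, aeval_X,
        Matrix.cons_val, pow_add, pow_zero, pow_one, one_mul]
      have h : ∀ u v : MvPolynomial (Fin 3) K,
          Polynomial.C (X 2) + Polynomial.X * (Polynomial.C u - Polynomial.C (X 2)) -
            (Polynomial.C (X 2) + Polynomial.X * (Polynomial.C v - Polynomial.C (X 2))) =
          Polynomial.X * (Polynomial.C u - Polynomial.C v) := fun u v => by ring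
      have h' : ∀ u : MvPolynomial (Fin 3) K, Polynomial.C (X 2) -
          (Polynomial.C (X 2) + Polynomial.X * (Polynomial.C u - Polynomial.C (X 2))) =
          Polynomial.X * (Polynomial.C (X 2) - Polynomial.C u) := fun u => by ring
      rw [h, h', add_sub_cancel_left]
      simp only [mul_pow]
      ring
    · refine (pow_dvd_pow _ h2).trans ⟨Polynomial.C (X 0 ^ A * X 1 ^ B * ph K 1 ^ F) *
        scaleVars K ![1, 1, 0] (X 2 ^ C * pf K 1 ^ D * pg K 1 ^ E), ?_⟩
      simp only [lineProd, scaleVars, pf, pg, ph, map_mul, map_pow, map_sub, aeval_X,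
        Matrix.cons_val, pow_add, pow_zero, pow_one, one_mul, ← mul_sub, mul_pow]
      ring
    · refine (pow_dvd_pow _ h3).trans ⟨Polynomial.C (X 1 ^ B * X 2 ^ C * pf K 1 ^ D) *
        scaleVars K ![0, 1, 1] (X 0 ^ A * pg K 1 ^ E * ph K 1 ^ F), ?_⟩
      simp only [lineProd, scaleVars, pf, pg, ph, map_mul, map_pow, map_sub, aeval_X,
        Matrix.cons_val, pow_add, pow_zero, pow_one, one_mul, ← mul_sub, mul_pow]
      ring
    · refine (pow_dvd_pow _ h4).trans ⟨Polynomial.C (X 2 ^ C * X 0 ^ A * pg K 1 ^ E) *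
        scaleVars K ![1, 0, 1] (X 1 ^ B * pf K 1 ^ D * ph K 1 ^ F), ?_⟩
      simp only [lineProd, scaleVars, pf, pg, ph, map_mul, map_pow, map_sub, aeval_X,
        Matrix.cons_val, pow_add, pow_zero, pow_one, one_mul, ← mul_sub, mul_pow]
      ring

theorem isHomogeneous_lineProd (A B C D E F : ℕ) :
    (lineProd K 1 A B C D E F).IsHomogeneous (A + B + C + D + E + F) := by
  have hX (i : Fin 3) (e : ℕ) : ((X i : MvPolynomial (Fin 3) K) ^ e).IsHomogeneous e :=
    isHomogeneous_X_pow i e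
  have hL (i j : Fin 3) (e : ℕ) :
      ((X i ^ 1 - X j ^ 1 : MvPolynomial (Fin 3) K) ^ e).IsHomogeneous e := by
    simpa using ((hX i 1).sub (hX j 1)).pow e
  exact (((((hX 0 A).mul (hX 1 B)).mul (hX 2 C)).mul (hL 1 2 D)).mul (hL 2 0 E)).mul (hL 0 1 F)

theorem Polynomial.X_pow_dvd_of_dvd_C_add_mul {R : Type*} [CommRing R] [IsDomain R] {s : ℕ}
    {P Q : Polynomial R} (hP : P.coeff 0 ≠ 0) (h : Polynomial.X ^ s ∣ P * Q) :
    Polynomial.X ^ s ∣ Q :=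
  Polynomial.prime_X.pow_dvd_of_dvd_mul_left s (by rwa [Polynomial.X_dvd_iff]) h

theorem Polynomial.X_pow_pred_dvd_of_dvd_X_mul_C_mul {R : Type*} [CommRing R] [IsDomain R] {s : ℕ}
    {a : R} {Q : Polynomial R} (ha : a ≠ 0)
    (h : Polynomial.X ^ s ∣ Polynomial.X * Polynomial.C a * Q) :
    Polynomial.X ^ (s - 1) ∣ Q := by
  cases s with
  | zero => simp
  | succ s =>
    rw [pow_succ', mul_assoc, mul_dvd_mul_iff_left Polynomial.X_ne_zero] at h
    exact Polynomial.X_pow_dvd_of_dvd_C_add_mul (by simpa) h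

theorem X_sub_X_ne_zero {i j : Fin 3} (h : i ≠ j) : (X i - X j : MvPolynomial (Fin 3) K) ≠ 0 :=
  sub_ne_zero.2 fun h' => h (X_injective h')

theorem VanishesTo.of_ph_mul {Q : MvPolynomial (Fin 3) K}
    (h : VanishesTo m p q r ((X 0 - X 1) * Q)) : VanishesTo (m - 1) (p - 1) q r Q where
  unit := by
    refine Polynomial.X_pow_pred_dvd_of_dvd_X_mul_C_mul (X_sub_X_ne_zero (i := 0) (j := 1)
      (by decide)) ?_
    convert h.unit using 1
    simp only [scaleUnit, map_mul, map_sub, aeval_X, Matrix.cons_val]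
    ring
  xy := by
    refine Polynomial.X_pow_pred_dvd_of_dvd_X_mul_C_mul (X_sub_X_ne_zero (i := 0) (j := 1)
      (by decide)) ?_
    convert h.xy using 1
    simp only [scaleVars, map_mul, map_sub, aeval_X, Matrix.cons_val]
    ring
  yz := by
    have := h.yz
    rw [map_mul] at this
    refine Polynomial.X_pow_dvd_of_dvd_C_add_mul ?_ this
    simp [scaleVars]
  zx := by
    have := h.zx
    rw [map_mul] at this
    refine Polynomial.X_pow_dvd_of_dvd_C_add_mul ?_ this
    simp [scaleVars]

theorem VanishesTo.of_X_two_mul {Q : MvPolynomial (Fin 3) K}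
    (h : VanishesTo m p q r (X 2 * Q)) : VanishesTo m p (q - 1) (r - 1) Q where
  unit := by
    have := h.unit
    rw [map_mul] at this
    refine Polynomial.X_pow_dvd_of_dvd_C_add_mul ?_ this
    simp [scaleUnit]
  xy := by
    have := h.xy
    rw [map_mul] at this
    refine Polynomial.X_pow_dvd_of_dvd_C_add_mul ?_ this
    simp [scaleVars]
  yz := by
    refine Polynomial.X_pow_pred_dvd_of_dvd_X_mul_C_mul (X_ne_zero (2 : Fin 3)) ?_
    convert h.yz using 1
    simp [scaleVars]
  zx := by
    refine Polynomial.X_pow_pred_dvd_of_dvd_X_mul_C_mul (X_ne_zero (2 : Fin 3)) ?_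
    convert h.zx using 1
    simp [scaleVars]

theorem mul_mem_span_lineProds {L P : MvPolynomial (Fin 3) K} {m' p' q' r' : ℕ}
    (hL : ∀ Q ∈ lineProds K m p q r, L * Q ∈ lineProds K m' p' q' r')
    (hP : P ∈ Submodule.span K (lineProds K m p q r)) :
    L * P ∈ Submodule.span K (lineProds K m' p' q' r') := by
  induction hP using Submodule.span_induction with
  | zero => simp
  | add P Q _ _ hP hQ => rw [mul_add]; exact add_mem hP hQ
  | smul c P _ hP => rw [mul_smul_comm]; exact Submodule.smul_mem _ _ hP
  | mem P hP => exact Submodule.subset_span (hL P hP)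

theorem ph_mul_mem_lineProds {Q : MvPolynomial (Fin 3) K}
    (hQ : Q ∈ lineProds K (m - 1) (p - 1) q r) : (X 0 - X 1) * Q ∈ lineProds K m p q r := by
  obtain ⟨A, B, C, D, E, F, h1, h2, h3, h4, rfl⟩ := hQ
  refine ⟨A, B, C, D, E, F + 1, by omega, by omega, h3, h4, ?_⟩
  simp only [lineProd, ph, pow_one]
  ring

theorem X_two_mul_mem_lineProds {Q : MvPolynomial (Fin 3) K}
    (hQ : Q ∈ lineProds K m p (q - 1) (r - 1)) : X 2 * Q ∈ lineProds K m p q r := by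
  obtain ⟨A, B, C, D, E, F, h1, h2, h3, h4, rfl⟩ := hQ
  refine ⟨A, B, C + 1, D, E, F, h1, h2, by omega, by omega, ?_⟩
  simp only [lineProd]
  ring

theorem dvd_sub_aeval {σ R : Type*} [CommRing R] {L : MvPolynomial σ R} (v : σ → MvPolynomial σ R)
    (hv : ∀ i, L ∣ X i - v i) (P : MvPolynomial σ R) : L ∣ P - aeval v P := by
  induction P using MvPolynomial.induction_on with
  | C a => simp
  | add P Q hP hQ => rw [map_add, add_sub_add_comm]; exact dvd_add hP hQ
  | mul_X P i hP =>
    rw [map_mul, aeval_X, show P * X i - aeval v P * v i =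
      (P - aeval v P) * X i + aeval v P * (X i - v i) by ring]
    exact dvd_add (hP.mul_right _) ((hv i).mul_left _)

theorem MvPolynomial.homogeneousComponent_mul_of_isHomogeneous {σ R : Type*} [CommRing R]
    {P : MvPolynomial σ R} {e : ℕ} (hP : P.IsHomogeneous e) (Q : MvPolynomial σ R) (d : ℕ) :
    homogeneousComponent d (P * Q) =
      if e ≤ d then P * homogeneousComponent (d - e) Q else 0 := by
  conv_lhs => rw [← sum_homogeneousComponent Q, Finset.mul_sum, map_sum]
  have h (i : ℕ) : homogeneousComponent d (P * homogeneousComponent i Q) =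
      if e + i = d then P * homogeneousComponent i Q else 0 := by
    rw [homogeneousComponent_of_mem ((mem_homogeneousSubmodule _ _).2
      (hP.mul (homogeneousComponent_isHomogeneous i Q)))]
    simp only [eq_comm]
  simp only [h]
  split_ifs with hed
  · rw [Finset.sum_eq_single (d - e)]
    · rw [if_pos (by omega)]
    · intro i _ hi
      rw [if_neg (by omega)]
    · intro hi
      rw [homogeneousComponent_eq_zero _ _ (by rw [Finset.mem_range] at hi; omega)]
      simp
  · exact Finset.sum_eq_zero fun i _ => if_neg (by omega)

/-- A homogeneous multiple of a homogeneous polynomial has a homogeneous cofactor. -/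
theorem exists_isHomogeneous_cofactor {P G : MvPolynomial (Fin 3) K} {e : ℕ}
    (hP : P.IsHomogeneous e) (hG : G.IsHomogeneous d) (h : P ∣ G) :
    ∃ Q : MvPolynomial (Fin 3) K, Q.IsHomogeneous (d - e) ∧ G = P * Q ∧ (d < e → Q = 0) := by
  obtain ⟨Q, rfl⟩ := h
  have := MvPolynomial.homogeneousComponent_mul_of_isHomogeneous hP Q d
  rw [homogeneousComponent_eq_self hG] at this
  split_ifs at this with hed
  · exact ⟨_, homogeneousComponent_isHomogeneous _ _, this, fun h => by omega⟩
  · exact ⟨0, isHomogeneous_zero _ _ _, by simpa using this, fun _ => rfl⟩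

/-- Restriction to the line `x = y`. -/
def restrictDiag (K : Type*) [Field K] : MvPolynomial (Fin 3) K →ₐ[K] MvPolynomial (Fin 3) K :=
  aeval ![X 0, X 0, X 2]

theorem VanishesTo.dvd_restrictDiag {P : MvPolynomial (Fin 3) K} (h : VanishesTo m p q r P) :
    (X 0 - X 2) ^ m * X 0 ^ p ∣ restrictDiag K P := by
  have h1 : (X 0 - X 2) ^ m ∣ restrictDiag K P := by
    let φ : Polynomial (MvPolynomial (Fin 3) K) →ₐ[K] MvPolynomial (Fin 3) K :=
      Polynomial.aevalTower (aeval ![X 2 + 1, X 2 + 1, X 2]) (X 0 - X 2)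
    have hφ : φ.comp (scaleUnit K) = restrictDiag K := by
      ext i
      fin_cases i <;> simp [φ, scaleUnit, restrictDiag]
    rw [← hφ]
    simpa [φ] using map_dvd φ h.unit
  have h2 : X 0 ^ p ∣ restrictDiag K P := by
    let φ : Polynomial (MvPolynomial (Fin 3) K) →ₐ[K] MvPolynomial (Fin 3) K :=
      Polynomial.aevalTower (aeval ![1, 1, X 2]) (X 0)
    have hφ : φ.comp (scaleVars K ![1, 1, 0]) = restrictDiag K := by
      ext i
      fin_cases i <;> simp [φ, scaleVars, restrictDiag]
    rw [← hφ]
    simpa [φ] using map_dvd φ h.xy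
  obtain ⟨Q, hQ⟩ := h1
  rw [hQ] at h2 ⊢
  refine mul_dvd_mul_left _ ((X_prime (i := (0 : Fin 3))).pow_dvd_of_dvd_mul_left p ?_ h2)
  intro h0
  have := map_dvd (eval ![(0 : K), 0, 1]) h0
  simp at this

theorem VanishesTo.X_two_dvd {P : MvPolynomial (Fin 3) K} (h : VanishesTo m p q r P)
    (hP : P.IsHomogeneous d) (hd : d < q + r) : X 2 ∣ P := by
  let ρ : MvPolynomial (Fin 3) K →ₐ[K] MvPolynomial (Fin 3) K := aeval ![X 0, X 1, 0]
  have h1 : X 1 ^ q ∣ ρ P := by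
    let φ : Polynomial (MvPolynomial (Fin 3) K) →ₐ[K] MvPolynomial (Fin 3) K :=
      Polynomial.aevalTower (aeval ![X 0, 1, 0]) (X 1)
    have hφ : φ.comp (scaleVars K ![0, 1, 1]) = ρ := by
      ext i
      fin_cases i <;> simp [φ, scaleVars, ρ]
    rw [← hφ]
    simpa [φ] using map_dvd φ h.yz
  have h2 : X 0 ^ r ∣ ρ P := by
    let φ : Polynomial (MvPolynomial (Fin 3) K) →ₐ[K] MvPolynomial (Fin 3) K :=
      Polynomial.aevalTower (aeval ![1, X 1, 0]) (X 0)
    have hφ : φ.comp (scaleVars K ![1, 0, 1]) = ρ := by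
      ext i
      fin_cases i <;> simp [φ, scaleVars, ρ]
    rw [← hφ]
    simpa [φ] using map_dvd φ h.zx
  have h3 : X 1 ^ q * X 0 ^ r ∣ ρ P := by
    obtain ⟨Q, hQ⟩ := h1
    rw [hQ] at h2 ⊢
    refine mul_dvd_mul_left _ ((X_prime (i := (0 : Fin 3))).pow_dvd_of_dvd_mul_left r ?_ h2)
    intro h0
    have := map_dvd (eval ![(0 : K), 1, 0]) h0
    simp at this
  have hv (i : Fin 3) : (![X 0, X 1, 0] i : MvPolynomial (Fin 3) K).IsHomogeneous 1 := by
    fin_cases i <;> simp [isHomogeneous_X, isHomogeneous_zero]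
  have hρ : (ρ P).IsHomogeneous d := by
    simpa only [one_mul] using hP.aeval _ hv
  obtain ⟨Q, -, hQ, hQ0⟩ := exists_isHomogeneous_cofactor
    ((isHomogeneous_X_pow 1 q).mul (isHomogeneous_X_pow 0 r)) hρ h3
  have : X 2 ∣ P - ρ P := dvd_sub_aeval _ (fun i => by fin_cases i <;> simp) P
  rwa [hQ, hQ0 hd, mul_zero, sub_zero] at this

theorem exists_mem_span_restrictDiag_eq {P : MvPolynomial (Fin 3) K} (h : VanishesTo m p q r P)
    (hP : P.IsHomogeneous d) (hd : q + r ≤ d) :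
    ∃ M ∈ Submodule.span K (lineProds K m p q r), M.IsHomogeneous d ∧
      restrictDiag K M = restrictDiag K P := by
  have hv (i : Fin 3) : (![X 0, X 0, X 2] i : MvPolynomial (Fin 3) K).IsHomogeneous 1 := by
    fin_cases i <;> simp [isHomogeneous_X]
  have hρ : (restrictDiag K P).IsHomogeneous d := by
    rw [restrictDiag]
    simpa only [one_mul] using hP.aeval _ hv
  have hidem : restrictDiag K (restrictDiag K P) = restrictDiag K P := by
    rw [← AlgHom.comp_apply]
    congr 1
    ext i
    fin_cases i <;> simp [restrictDiag]
  have hL : ((X 0 - X 2 : MvPolynomial (Fin 3) K) ^ m * X 0 ^ p).IsHomogeneous (m + p) := by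
    simpa using (((isHomogeneous_X K 0).sub (isHomogeneous_X K 2)).pow m).mul
      (isHomogeneous_X_pow 0 p)
  obtain ⟨Q, hQ, hPQ, hQ0⟩ := exists_isHomogeneous_cofactor hL hρ h.dvd_restrictDiag
  have hlift (s : Fin 3 →₀ ℕ) (hs : s ∈ Q.support) :
      ∃ M ∈ lineProds K m p q r, M.IsHomogeneous d ∧ ∃ c : K, c • restrictDiag K M =
        restrictDiag K ((X 0 - X 2) ^ m * X 0 ^ p * monomial s (coeff s Q)) := by
    have hdeg : s 0 + s 1 + s 2 = d - (m + p) := by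
      rw [hQ.degree_eq_sum_deg_support hs, ← Finsupp.degree_apply, Finsupp.degree_eq_sum,
        Fin.sum_univ_three]
    have hle : m + p ≤ d := by
      by_contra! hlt
      simp [hQ0 hlt] at hs
    obtain ⟨D, E, A, B, h1, h2, h3, h4⟩ : ∃ D E A B, D + E = m ∧ A + B = p + s 0 + s 1 ∧
        q ≤ B + s 2 + D ∧ r ≤ s 2 + A + E :=
      ⟨min m (q - s 2), m - min m (q - s 2),
        p + s 0 + s 1 - (q - s 2 - min m (q - s 2)), q - s 2 - min m (q - s 2),
        by omega, by omega, by omega, by omega⟩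
    refine ⟨lineProd K 1 A B (s 2) D E 0, ⟨A, B, s 2, D, E, 0, by omega, by omega, h3, h4, rfl⟩,
      ?_, (-1) ^ E * coeff s Q, ?_⟩
    · convert isHomogeneous_lineProd (K := K) A B (s 2) D E 0 using 1
      omega
    · rw [monomial_eq, Finsupp.prod_fintype _ _ (by simp), Fin.prod_univ_three, smul_eq_C_mul]
      simp only [restrictDiag, lineProd, pf, pg, ph, map_mul, map_pow, map_sub, aeval_X,
        Matrix.cons_val, pow_zero, pow_one, mul_one, algHom_C, algebraMap_eq, map_neg, map_one]
      have e1 : (X 0 : MvPolynomial (Fin 3) K) ^ A * X 0 ^ B = X 0 ^ p * X 0 ^ s 0 * X 0 ^ s 1 := by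
        rw [← pow_add, ← pow_add, ← pow_add, h2]
      rw [e1, ← neg_sub (X 0) (X 2), neg_pow (X 0 - X 2), ← h1, pow_add]
      have e2 : (-1 : MvPolynomial (Fin 3) K) ^ E * (-1) ^ E = 1 := by
        rw [← mul_pow]; simp
      linear_combination (C (coeff s Q) * X 0 ^ p * X 0 ^ s 0 * X 0 ^ s 1 * X 2 ^ s 2 *
        (X 0 - X 2) ^ D * (X 0 - X 2) ^ E) * e2
  choose! M hM hMd c hc using hlift
  refine ⟨∑ s ∈ Q.support, c s • M s, sum_mem fun s hs => Submodule.smul_mem _ _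
    (Submodule.subset_span (hM s hs)), ?_, ?_⟩
  · refine IsHomogeneous.sum _ _ _ fun s hs => ?_
    rw [smul_eq_C_mul]
    exact (hMd s hs).C_mul _
  · rw [map_sum, ← hidem, hPQ]
    conv_rhs => rw [as_sum Q, Finset.mul_sum, map_sum]
    exact Finset.sum_congr rfl fun s hs => by rw [map_smul, hc s hs]

/-- Forms with prescribed vanishing orders at four general points of the plane are spanned by
products of the six lines through pairs of the points. -/
theorem VanishesTo.mem_span_lineProds {P : MvPolynomial (Fin 3) K} (h : VanishesTo m p q r P)
    (hP : P.IsHomogeneous d) : P ∈ Submodule.span K (lineProds K m p q r) := by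
  induction d using Nat.strong_induction_on generalizing m p q r P with
  | _ d ih =>
  rcases lt_or_ge d (q + r) with hd | hd
  · obtain ⟨Q, hQ, rfl, hQ0⟩ := exists_isHomogeneous_cofactor (isHomogeneous_X K 2) hP
      (h.X_two_dvd hP hd)
    rcases Nat.eq_zero_or_pos d with rfl | hpos
    · simp [hQ0 one_pos]
    · exact mul_mem_span_lineProds (fun _ => X_two_mul_mem_lineProds)
        (ih _ (by omega) h.of_X_two_mul hQ)
  · obtain ⟨M, hM, hMd, hMP⟩ := exists_mem_span_restrictDiag_eq h hP hd
    have hdvd : X 0 - X 1 ∣ P - M := by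
      have := dvd_sub_aeval (L := X 0 - X 1) ![X 0, X 0, X 2] (fun i => by
        fin_cases i
        exacts [by simp, ⟨-1, by simp⟩, by simp]) (P - M)
      rwa [← restrictDiag, map_sub, hMP, sub_self, sub_zero] at this
    obtain ⟨Q, hQ, hPQ, hQ0⟩ := exists_isHomogeneous_cofactor
      ((isHomogeneous_X K 0).sub (isHomogeneous_X K 1)) (hP.sub hMd) hdvd
    have hPM : P - M ∈ Submodule.span K (lineProds K m p q r) := by
      have hv := h.sub (vanishesTo_of_mem_span hM)
      rw [hPQ] at hv ⊢
      rcases Nat.eq_zero_or_pos d with rfl | hpos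
      · simp [hQ0 one_pos]
      · exact mul_mem_span_lineProds (fun _ => ph_mul_mem_lineProds)
          (ih _ (by omega) hv.of_ph_mul hQ)
    simpa using add_mem hPM hM

end FourPoints

section Residues

variable {K : Type*} [Field K] {n : ℕ}

/-- The coefficient of `x^{e 0} y^{e 1} z^{e 2}` when a polynomial is written as a combination of
such monomials over `K[xⁿ, yⁿ, zⁿ]`, regarded as a polynomial in `xⁿ, yⁿ, zⁿ`. -/
def residuePart (K : Type*) [Field K] (n : ℕ) (e : Fin 3 →₀ ℕ) :
    MvPolynomial (Fin 3) K →ₗ[K] MvPolynomial (Fin 3) K :=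
  (basisMonomials (Fin 3) K).constr K fun s =>
    if s.mapRange (· % n) (Nat.zero_mod n) = e then
      monomial (s.mapRange (· / n) (Nat.zero_div n)) 1 else 0

theorem residuePart_monomial (e s : Fin 3 →₀ ℕ) (c : K) :
    residuePart K n e (monomial s c) = if s.mapRange (· % n) (Nat.zero_mod n) = e then
      monomial (s.mapRange (· / n) (Nat.zero_div n)) c else 0 := by
  have h : monomial s c = c • basisMonomials (Fin 3) K s := by simp [smul_monomial]
  rw [h, map_smul, residuePart, Module.Basis.constr_basis, smul_ite, smul_zero, smul_monomial,
    smul_eq_mul, mul_one]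

theorem residuePart_expand_mul (hn : 0 < n) (e : Fin 3 →₀ ℕ) (P Q : MvPolynomial (Fin 3) K) :
    residuePart K n e (expand n P * Q) = P * residuePart K n e Q := by
  induction P using MvPolynomial.induction_on' with
  | add P P' hP hP' => simp only [map_add, add_mul, hP, hP']
  | monomial u a =>
    induction Q using MvPolynomial.induction_on' with
    | add Q Q' hQ hQ' => simp only [map_add, mul_add, hQ, hQ']
    | monomial v b =>
      rw [expand_monomial, monomial_mul, residuePart_monomial, residuePart_monomial]
      have h1 : (n • u + v).mapRange (· % n) (Nat.zero_mod n) =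
          v.mapRange (· % n) (Nat.zero_mod n) := by
        ext i; simp
      have h2 : (n • u + v).mapRange (· / n) (Nat.zero_div n) =
          u + v.mapRange (· / n) (Nat.zero_div n) := by
        ext i; simp [Nat.mul_add_div hn]
      rw [h1, h2]
      split_ifs <;> simp [monomial_mul]

theorem sum_monomial_mul_expand_residuePart (P : MvPolynomial (Fin 3) K) :
    P = ∑ e ∈ P.support.image fun s => s.mapRange (· % n) (Nat.zero_mod n),
      monomial e 1 * expand n (residuePart K n e P) := by
  have h (s : Fin 3 →₀ ℕ) (hs : s ∈ P.support) :
      ∑ e ∈ P.support.image fun s => s.mapRange (· % n) (Nat.zero_mod n),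
        monomial e 1 * expand n (residuePart K n e (monomial s (coeff s P))) =
      monomial s (coeff s P) := by
    rw [Finset.sum_eq_single (s.mapRange (· % n) (Nat.zero_mod n))]
    · rw [residuePart_monomial, if_pos rfl, expand_monomial, monomial_mul, one_mul]
      congr 2
      ext i
      simp [Nat.mod_add_div]
    · intro e _ he
      rw [residuePart_monomial, if_neg he.symm, map_zero, mul_zero]
    · exact fun h => absurd (Finset.mem_image_of_mem _ hs) h
  conv_lhs => rw [as_sum P, ← Finset.sum_congr rfl h, Finset.sum_comm]
  refine Finset.sum_congr rfl fun e _ => ?_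
  rw [← Finset.mul_sum, ← map_sum, ← map_sum, ← as_sum P]

theorem residuePart_eq_sum (e : Fin 3 →₀ ℕ) (P : MvPolynomial (Fin 3) K) :
    residuePart K n e P = ∑ s ∈ P.support, if s.mapRange (· % n) (Nat.zero_mod n) = e then
      monomial (s.mapRange (· / n) (Nat.zero_div n)) (coeff s P) else 0 := by
  conv_lhs => rw [as_sum P, map_sum]
  exact Finset.sum_congr rfl fun s _ => residuePart_monomial _ _ _

theorem residuePart_mem_Ifg_pow (hn : 0 < n) (e : Fin 3 →₀ ℕ) {m : ℕ}
    {P : MvPolynomial (Fin 3) K} (hP : P ∈ Ifg K n ^ m) :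
    residuePart K n e P ∈ Ifg K 1 ^ m := by
  have hmap : Ifg K n ^ m = (Ifg K 1 ^ m).map (expand n) := by
    rw [Ideal.map_pow, Ifg, Ifg, Ideal.map_span, Set.image_pair]
    simp [pf, pg]
  rw [hmap, Ideal.map] at hP
  suffices h : ∀ Q, residuePart K n e (P * Q) ∈ Ifg K 1 ^ m by simpa using h 1
  induction hP using Submodule.span_induction with
  | zero => simp
  | add P P' _ _ hP hP' => intro Q; rw [add_mul, map_add]; exact add_mem (hP Q) (hP' Q)
  | smul a P _ hP => intro Q; rw [smul_eq_mul, mul_comm a, mul_assoc]; exact hP _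
  | mem P hP =>
    obtain ⟨T, hT, rfl⟩ := hP
    intro Q
    exact (residuePart_expand_mul hn e T Q).symm ▸ Ideal.mul_mem_right _ _ hT

theorem X_pow_dvd_scaleUnit_of_mem {m : ℕ} {P : MvPolynomial (Fin 3) K} (hP : P ∈ Ifg K 1 ^ m) :
    Polynomial.X ^ m ∣ scaleUnit K P := by
  have hle : Ifg K 1 ≤ (Ideal.span {Polynomial.X}).comap (scaleUnit K) := by
    rw [Ifg, Ideal.span_le, Set.insert_subset_iff, Set.singleton_subset_iff]
    simp only [SetLike.mem_coe, Ideal.mem_comap, Ideal.mem_span_singleton]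
    constructor
    · exact ⟨Polynomial.C (X 1 - X 2), by simp [pf, scaleUnit]⟩
    · exact ⟨Polynomial.C (X 2 - X 0), by simp [pg, scaleUnit]; ring⟩
  have := Ideal.le_comap_pow (scaleUnit K) m (Ideal.pow_right_mono hle m hP)
  rwa [Ideal.mem_comap, Ideal.span_singleton_pow, Ideal.mem_span_singleton] at this

theorem le_add_of_mem_span_pair_pow {σ : Type*} {i j : σ} {m : ℕ} {P : MvPolynomial σ K}
    (hP : P ∈ Ideal.span {X i, X j} ^ m) {s : σ →₀ ℕ} (hs : s ∈ P.support) : m ≤ s i + s j := by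
  classical
  induction m generalizing P s with
  | zero => exact Nat.zero_le _
  | succ m ih =>
    rw [pow_succ] at hP
    induction hP using Submodule.mul_induction_on' with
    | add P _ Q _ hP hQ =>
      rcases Finset.mem_union.1 (support_add hs) with h | h
      exacts [hP h, hQ h]
    | mem_mul_mem P hP Q hQ =>
      obtain ⟨u, hu, v, hv, rfl⟩ := Finset.mem_add.1 (support_mul _ _ hs)
      have h1 := ih hP hu
      have h2 : 1 ≤ v i + v j := by
        rw [← Set.image_pair, mem_ideal_span_X_image] at hQ
        obtain ⟨l, rfl | rfl, hl⟩ := hQ v hv <;> omega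
      simp only [Finsupp.add_apply]
      omega

theorem X_pow_dvd_scaleVars_residuePart {w : Fin 3 → ℕ} {e : Fin 3 →₀ ℕ} {m : ℕ}
    {P : MvPolynomial (Fin 3) K}
    (h : ∀ s ∈ P.support, (∀ i, s i % n = e i) →
      m ≤ w 0 * (s 0 / n) + w 1 * (s 1 / n) + w 2 * (s 2 / n)) :
    Polynomial.X ^ m ∣ scaleVars K w (residuePart K n e P) := by
  rw [residuePart_eq_sum, map_sum]
  refine Finset.dvd_sum fun s hs => ?_
  split_ifs with hse
  · refine (pow_dvd_pow _ (h s hs fun i => DFunLike.congr_fun hse i)).trans ?_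
    rw [scaleVars, aeval_monomial, Finsupp.prod_fintype _ _ (by simp), Fin.prod_univ_three]
    simp only [Finsupp.mapRange_apply, mul_pow, ← pow_mul, pow_add]
    exact Dvd.intro (algebraMap K _ (coeff s P) * (Polynomial.C (X 0) ^ (s 0 / n) *
      Polynomial.C (X 1) ^ (s 1 / n) * Polynomial.C (X 2) ^ (s 2 / n))) (by ring)
  · simp

theorem isHomogeneous_residuePart (hn : 0 < n) {e : Fin 3 →₀ ℕ} {d : ℕ}
    {P : MvPolynomial (Fin 3) K} (hP : P.IsHomogeneous d) :
    (residuePart K n e P).IsHomogeneous ((d - (e 0 + e 1 + e 2)) / n) := by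
  rw [residuePart_eq_sum]
  refine IsHomogeneous.sum _ _ _ fun s hs => ?_
  split_ifs with hse
  · refine isHomogeneous_monomial _ ?_
    have hdeg := hP.degree_eq_sum_deg_support hs
    rw [← Finsupp.degree_apply, Finsupp.degree_eq_sum, Fin.sum_univ_three] at hdeg
    rw [Finsupp.degree_eq_sum, Fin.sum_univ_three, ← hse, hdeg]
    simp only [Finsupp.mapRange_apply]
    refine (Nat.div_eq_of_eq_mul_right hn ?_).symm
    have h0 := Nat.mod_add_div (s 0) n
    have h1 := Nat.mod_add_div (s 1) n
    have h2 := Nat.mod_add_div (s 2) n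
    rw [mul_add, mul_add]
    omega
  · exact isHomogeneous_zero _ _ _

theorem sub_div_le_of_residues (hn : 0 < n) {k a b ea eb : ℕ} (h : k * n ≤ a + b)
    (ha : a % n = ea) (hb : b % n = eb) : k - (ea + eb) / n ≤ a / n + b / n := by
  subst ha hb
  have hab : a + b = a % n + b % n + n * (a / n + b / n) := by
    have h1 := Nat.mod_add_div a n
    have h2 := Nat.mod_add_div b n
    rw [mul_add]
    omega
  have hdiv := Nat.div_le_div_right (c := n) h
  rw [Nat.mul_div_cancel _ hn, hab, Nat.add_mul_div_left _ _ hn] at hdiv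
  exact Nat.sub_le_iff_le_add'.2 hdiv

theorem residuePart_mem_span_lineProds (hn : 0 < n) {k d : ℕ} {P : MvPolynomial (Fin 3) K}
    (hP : P.IsHomogeneous d) (hPs : P ∈ symbPow K n (k * n)) (e : Fin 3 →₀ ℕ) :
    residuePart K n e P ∈ Submodule.span K (lineProds K (k * n) (k - (e 0 + e 1) / n)
      (k - (e 1 + e 2) / n) (k - (e 2 + e 0) / n)) := by
  obtain ⟨⟨⟨h0, h1⟩, h2⟩, h3⟩ := hPs
  refine VanishesTo.mem_span_lineProds ⟨?_, ?_, ?_, ?_⟩ (isHomogeneous_residuePart hn hP)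
  · exact X_pow_dvd_scaleUnit_of_mem (residuePart_mem_Ifg_pow hn e h0)
  · refine X_pow_dvd_scaleVars_residuePart fun s hs hse => ?_
    simpa using sub_div_le_of_residues hn (le_add_of_mem_span_pair_pow h1 hs) (hse 0) (hse 1)
  · refine X_pow_dvd_scaleVars_residuePart fun s hs hse => ?_
    simpa using sub_div_le_of_residues hn (le_add_of_mem_span_pair_pow h2 hs) (hse 1) (hse 2)
  · refine X_pow_dvd_scaleVars_residuePart fun s hs hse => ?_
    simpa [add_comm] using
      sub_div_le_of_residues hn (le_add_of_mem_span_pair_pow h3 hs) (hse 2) (hse 0)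

theorem monomial_mul_expand_lineProd (e : Fin 3 →₀ ℕ) (A B C D E F : ℕ) :
    monomial e 1 * expand n (lineProd K 1 A B C D E F) =
      lineProd K n (e 0 + n * A) (e 1 + n * B) (e 2 + n * C) D E F := by
  rw [monomial_eq, Finsupp.prod_fintype _ _ (by simp), Fin.prod_univ_three]
  simp only [lineProd, pf, pg, ph, map_mul, map_pow, map_sub, expand_X, map_one, pow_add, pow_mul,
    pow_one]
  ring

end Residues

section SymbolicPowers

variable {K : Type*} [Field K] {n : ℕ}

theorem X_pow_mul_X_pow_mul_pow_mem {i j : Fin 3} {A B F m : ℕ} (h : m ≤ A + B + n * F) :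
    (X i ^ A * X j ^ B * (X i ^ n - X j ^ n) ^ F : MvPolynomial (Fin 3) K) ∈
      Ideal.span {X i, X j} ^ m := by
  have hi : (X i : MvPolynomial (Fin 3) K) ∈ Ideal.span {X i, X j} := Ideal.subset_span (by simp)
  have hj : (X j : MvPolynomial (Fin 3) K) ∈ Ideal.span {X i, X j} := Ideal.subset_span (by simp)
  refine Ideal.pow_le_pow_right h ?_
  rw [pow_add, pow_add, pow_mul]
  exact Ideal.mul_mem_mul (Ideal.mul_mem_mul (Ideal.pow_mem_pow hi A) (Ideal.pow_mem_pow hj B))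
    (Ideal.pow_mem_pow (sub_mem (Ideal.pow_mem_pow hi n) (Ideal.pow_mem_pow hj n)) F)

theorem lineProd_mem_symbPow {A B C D E F m : ℕ} (h0 : m ≤ D + E + F) (h1 : m ≤ A + B + n * F)
    (h2 : m ≤ B + C + n * D) (h3 : m ≤ C + A + n * E) :
    lineProd K n A B C D E F ∈ symbPow K n m := by
  refine ⟨⟨⟨?_, ?_⟩, ?_⟩, ?_⟩
  · have hf : pf K n ∈ Ifg K n := Ideal.subset_span (by simp)
    have hg : pg K n ∈ Ifg K n := Ideal.subset_span (by simp)
    have hh : ph K n ∈ Ifg K n := by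
      rw [show ph K n = -(pf K n + pg K n) by simp only [pf, pg, ph]; ring]
      exact neg_mem (add_mem hf hg)
    have := Ideal.mul_mem_mul (Ideal.mul_mem_mul (Ideal.pow_mem_pow hf D)
      (Ideal.pow_mem_pow hg E)) (Ideal.pow_mem_pow hh F)
    rw [← pow_add, ← pow_add] at this
    refine Ideal.mem_of_dvd _ ?_ (Ideal.pow_le_pow_right h0 this)
    exact Dvd.intro_left (X 0 ^ A * X 1 ^ B * X 2 ^ C) (by rw [lineProd]; ring)
  · refine Ideal.mem_of_dvd _ ?_ (X_pow_mul_X_pow_mul_pow_mem (i := 0) (j := 1) h1)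
    exact Dvd.intro (X 2 ^ C * pf K n ^ D * pg K n ^ E) (by rw [lineProd, ph]; ring)
  · refine Ideal.mem_of_dvd _ ?_ (X_pow_mul_X_pow_mul_pow_mem (i := 1) (j := 2) h2)
    exact Dvd.intro (X 0 ^ A * pg K n ^ E * ph K n ^ F) (by rw [lineProd, pf]; ring)
  · refine Ideal.mem_of_dvd _ ?_ (X_pow_mul_X_pow_mul_pow_mem (i := 2) (j := 0) h3)
    exact Dvd.intro (X 1 ^ B * pf K n ^ D * ph K n ^ F) (by rw [lineProd, pg]; ring)

theorem exists_splitting_of_two_conditions {n N A B C e₁ e₂ f₁ f₂ : ℕ}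
    (he : (e₁ = 0 ∧ e₂ = 0 ∧ N + n ≤ C + A) ∨ (n ≤ e₁ ∧ N ≤ C + A + e₂))
    (hf : (f₁ = 0 ∧ f₂ = 0 ∧ N + n ≤ A + B) ∨ (n ≤ f₁ ∧ N ≤ A + B + f₂)) :
    ∃ A₁ A₂ B₁ B₂ C₁ C₂ : ℕ, (A = A₁ + A₂ ∧ B = B₁ + B₂ ∧ C = C₁ + C₂) ∧
      (n ≤ C₁ + A₁ + e₁ ∧ N ≤ C₂ + A₂ + e₂) ∧ n ≤ A₁ + B₁ + f₁ ∧ N ≤ A₂ + B₂ + f₂ := by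
  rcases he with ⟨rfl, rfl, he⟩ | ⟨he, he'⟩ <;> rcases hf with ⟨rfl, rfl, hf⟩ | ⟨hf, hf'⟩
  · rcases le_total A n with h | h
    · exact ⟨A, 0, n - A, B - (n - A), n - A, C - (n - A), by omega, by omega, by omega⟩
    · exact ⟨n, A - n, 0, B, 0, C, by omega, by omega, by omega⟩
  · rcases le_total C n with h | h
    · exact ⟨n - C, A - (n - C), 0, B, C, 0, by omega, by omega, by omega⟩
    · exact ⟨0, A, 0, B, n, C - n, by omega, by omega, by omega⟩
  · rcases le_total B n with h | h
    · exact ⟨n - B, A - (n - B), B, 0, 0, C, by omega, by omega, by omega⟩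
    · exact ⟨0, A, n, B - n, 0, C, by omega, by omega, by omega⟩
  · exact ⟨0, A, 0, B, 0, C, by omega, by omega, by omega⟩

/-- A part of `D` of size at most `u`, positive if `D` is, whose removal leaves at least `j`
unless the part is `1`; it is as large as possible. -/
theorem exists_bounded_part (j D u : ℕ) (hu : D = 0 ∨ 1 ≤ u) :
    ∃ D₁ D₂, D = D₁ + D₂ ∧ (D₁ = 0 → D₂ = 0) ∧ (D₁ ≤ 1 ∨ j ≤ D₂) ∧ D₁ ≤ u ∧
      (D₁ = u ∨ D ≤ D₁ + j) := by
  rcases Nat.eq_zero_or_pos D with rfl | hD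
  · exact ⟨0, 0, by omega⟩
  · rcases le_or_gt D (j + 1) with h | h
    · exact ⟨1, D - 1, by omega⟩
    · rcases le_total u (D - j) with h' | h'
      · exact ⟨u, D - u, by omega⟩
      · exact ⟨D - j, j, by omega⟩

theorem exists_three_parts {n j D E F : ℕ} (hn : 3 ≤ n) (h : 3 * j + n ≤ D + E + F) :
    ∃ D₁ D₂ E₁ E₂ F₁ F₂, D = D₁ + D₂ ∧ E = E₁ + E₂ ∧ F = F₁ + F₂ ∧ D₁ + E₁ + F₁ = n ∧
      ((D₁ = 0 → D₂ = 0) ∧ (D₁ ≤ 1 ∨ j ≤ D₂)) ∧ ((E₁ = 0 → E₂ = 0) ∧ (E₁ ≤ 1 ∨ j ≤ E₂)) ∧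
      (F₁ = 0 → F₂ = 0) ∧ (F₁ ≤ 1 ∨ j ≤ F₂) := by
  obtain ⟨e, he1, heE, he0⟩ : ∃ e ≤ 1, e ≤ E ∧ (E = 0 ∨ e = 1) := ⟨min E 1, by omega⟩
  obtain ⟨f, hf1, hfF, hf0⟩ : ∃ f ≤ 1, f ≤ F ∧ (F = 0 ∨ f = 1) := ⟨min F 1, by omega⟩
  obtain ⟨D₁, D₂, rfl, hD, hD', hDu, hDm⟩ := exists_bounded_part j D (n - e - f) (by omega)
  obtain ⟨E₁, E₂, rfl, hE, hE', hEu, hEm⟩ := exists_bounded_part j E (n - D₁ - f) (by omega)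
  obtain ⟨F₁, F₂, rfl, hF, hF', hFu, hFm⟩ := exists_bounded_part j F (n - D₁ - E₁) (by omega)
  exact ⟨D₁, D₂, E₁, E₂, F₁, F₂, rfl, rfl, rfl, by omega, ⟨hD, hD'⟩, ⟨hE, hE'⟩, hF, hF'⟩

theorem splitting_condition {n j D₁ D₂ S : ℕ} (hD : D₁ = 0 → D₂ = 0) (hD' : D₁ ≤ 1 ∨ j ≤ D₂)
    (h : (j + 1) * n ≤ S + n * (D₁ + D₂)) :
    (n * D₁ = 0 ∧ n * D₂ = 0 ∧ j * n + n ≤ S) ∨ (n ≤ n * D₁ ∧ j * n ≤ S + n * D₂) := by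
  rw [add_mul, one_mul, mul_add] at h
  rcases Nat.eq_zero_or_pos D₁ with rfl | hpos
  · simp_all
  · refine Or.inr ⟨Nat.le_mul_of_pos_right n hpos, ?_⟩
    rcases hD' with h1 | h1
    · obtain rfl : D₁ = 1 := by omega
      omega
    · have := Nat.mul_le_mul_left n h1
      rw [mul_comm j]
      omega

theorem exists_exponent_splitting {j A B C D E F : ℕ} (hn : 3 ≤ n)
    (h0 : (j + 1) * n ≤ D + E + F) (h1 : (j + 1) * n ≤ A + B + n * F)
    (h2 : (j + 1) * n ≤ B + C + n * D) (h3 : (j + 1) * n ≤ C + A + n * E) :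
    ∃ A₁ A₂ B₁ B₂ C₁ C₂ D₁ D₂ E₁ E₂ F₁ F₂ : ℕ,
      (A = A₁ + A₂ ∧ B = B₁ + B₂ ∧ C = C₁ + C₂ ∧ D = D₁ + D₂ ∧ E = E₁ + E₂ ∧ F = F₁ + F₂) ∧
      (n ≤ D₁ + E₁ + F₁ ∧ n ≤ A₁ + B₁ + n * F₁ ∧ n ≤ B₁ + C₁ + n * D₁ ∧ n ≤ C₁ + A₁ + n * E₁) ∧
      (j * n ≤ D₂ + E₂ + F₂ ∧ j * n ≤ A₂ + B₂ + n * F₂ ∧ j * n ≤ B₂ + C₂ + n * D₂ ∧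
        j * n ≤ C₂ + A₂ + n * E₂) := by
  rw [add_mul, one_mul] at h0
  have hjn : j * 3 ≤ j * n := Nat.mul_le_mul_left j hn
  obtain ⟨D₁, D₂, E₁, E₂, F₁, F₂, rfl, rfl, rfl, hsum, ⟨hD, hD'⟩, ⟨hE, hE'⟩, hF, hF'⟩ :=
    exists_three_parts (j := j) hn (by omega : 3 * j + n ≤ D + E + F)
  have cD := splitting_condition hD hD' h2
  have cE := splitting_condition hE hE' h3
  have cF := splitting_condition hF hF' h1
  have free {x y : ℕ} (hx : 1 ≤ x) (hy : j ≤ y) (S T : ℕ) :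
      n ≤ S + n * x ∧ j * n ≤ T + n * y := by
    refine ⟨(Nat.le_mul_of_pos_right n hx).trans (Nat.le_add_left _ _), ?_⟩
    rw [mul_comm]
    exact (Nat.mul_le_mul_left n hy).trans (Nat.le_add_left _ _)
  have hfree : (1 ≤ D₁ ∧ j ≤ D₂) ∨ (1 ≤ E₁ ∧ j ≤ E₂) ∨ (1 ≤ F₁ ∧ j ≤ F₂) := by omega
  have hsum₂ : j * n ≤ D₂ + E₂ + F₂ := by omega
  rcases hfree with ⟨hx, hy⟩ | ⟨hx, hy⟩ | ⟨hx, hy⟩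
  · obtain ⟨A₁, A₂, B₁, B₂, C₁, C₂, ⟨rfl, rfl, rfl⟩, e, f⟩ :=
      exists_splitting_of_two_conditions cE cF
    have d := free hx hy (B₁ + C₁) (B₂ + C₂)
    exact ⟨A₁, A₂, B₁, B₂, C₁, C₂, D₁, D₂, E₁, E₂, F₁, F₂, ⟨rfl, rfl, rfl, rfl, rfl, rfl⟩,
      ⟨hsum.ge, f.1, d.1, e.1⟩, hsum₂, f.2, d.2, e.2⟩
  · obtain ⟨B₁, B₂, C₁, C₂, A₁, A₂, ⟨rfl, rfl, rfl⟩, f, d⟩ :=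
      exists_splitting_of_two_conditions cF cD
    have e := free hx hy (C₁ + A₁) (C₂ + A₂)
    exact ⟨A₁, A₂, B₁, B₂, C₁, C₂, D₁, D₂, E₁, E₂, F₁, F₂, ⟨rfl, rfl, rfl, rfl, rfl, rfl⟩,
      ⟨hsum.ge, f.1, d.1, e.1⟩, hsum₂, f.2, d.2, e.2⟩
  · obtain ⟨C₁, C₂, A₁, A₂, B₁, B₂, ⟨rfl, rfl, rfl⟩, d, e⟩ :=
      exists_splitting_of_two_conditions cD cE
    have f := free hx hy (A₁ + B₁) (A₂ + B₂)
    exact ⟨A₁, A₂, B₁, B₂, C₁, C₂, D₁, D₂, E₁, E₂, F₁, F₂, ⟨rfl, rfl, rfl, rfl, rfl, rfl⟩,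
      ⟨hsum.ge, f.1, d.1, e.1⟩, hsum₂, f.2, d.2, e.2⟩

theorem lineProd_mem_symbPow_mul {j A B C D E F : ℕ} (hn : 3 ≤ n)
    (h0 : (j + 1) * n ≤ D + E + F) (h1 : (j + 1) * n ≤ A + B + n * F)
    (h2 : (j + 1) * n ≤ B + C + n * D) (h3 : (j + 1) * n ≤ C + A + n * E) :
    lineProd K n A B C D E F ∈ symbPow K n n * symbPow K n (j * n) := by
  obtain ⟨A₁, A₂, B₁, B₂, C₁, C₂, D₁, D₂, E₁, E₂, F₁, F₂, ⟨rfl, rfl, rfl, rfl, rfl, rfl⟩,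
    ⟨a0, a1, a2, a3⟩, b0, b1, b2, b3⟩ := exists_exponent_splitting hn h0 h1 h2 h3
  have := Ideal.mul_mem_mul (lineProd_mem_symbPow (K := K) a0 a1 a2 a3)
    (lineProd_mem_symbPow (K := K) b0 b1 b2 b3)
  convert this using 1
  simp only [lineProd]
  ring

theorem symbPow_mul_le (a b : ℕ) : symbPow K n a * symbPow K n b ≤ symbPow K n (a + b) := by
  have h (I : Ideal (MvPolynomial (Fin 3) K)) (ha : symbPow K n a ≤ I ^ a)
      (hb : symbPow K n b ≤ I ^ b) : symbPow K n a * symbPow K n b ≤ I ^ (a + b) :=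
    pow_add I a b ▸ Ideal.mul_mono ha hb
  refine le_inf (le_inf (le_inf (h _ ?_ ?_) (h _ ?_ ?_)) (h _ ?_ ?_)) (h _ ?_ ?_) <;>
    exact fun P hP => by obtain ⟨⟨⟨h0, h1⟩, h2⟩, h3⟩ := hP; assumption

attribute [local instance] MvPolynomial.gradedAlgebra in
theorem homogeneousComponent_mem_symbPow {m : ℕ} {P : MvPolynomial (Fin 3) K}
    (hP : P ∈ symbPow K n m) (d : ℕ) : homogeneousComponent d P ∈ symbPow K n m := by
  have hpow (I : Ideal (MvPolynomial (Fin 3) K))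
      (hI : I.IsHomogeneous (homogeneousSubmodule (Fin 3) K)) (a : ℕ) :
      (I ^ a).IsHomogeneous (homogeneousSubmodule (Fin 3) K) := by
    induction a with
    | zero => simpa using Ideal.IsHomogeneous.top _
    | succ a ih => rw [pow_succ]; exact ih.mul hI
  have hspan (s t : MvPolynomial (Fin 3) K) (e : ℕ) (hs : s.IsHomogeneous e)
      (ht : t.IsHomogeneous e) :
      (Ideal.span {s, t}).IsHomogeneous (homogeneousSubmodule (Fin 3) K) := by
    refine Ideal.homogeneous_span _ _ fun x hx => ⟨e, ?_⟩
    obtain rfl | rfl := hx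
    exacts [hs, ht]
  have hX (i j : Fin 3) := hspan (X i) (X j) 1 (isHomogeneous_X K i) (isHomogeneous_X K j)
  have hfg := hspan (pf K n) (pg K n) n
    ((isHomogeneous_X_pow 1 n).sub (isHomogeneous_X_pow 2 n))
    ((isHomogeneous_X_pow 2 n).sub (isHomogeneous_X_pow 0 n))
  exact homogeneousComponent_mem_of_mem ((((hpow _ hfg m).inf (hpow _ (hX 0 1) m)).inf
    (hpow _ (hX 1 2) m)).inf (hpow _ (hX 2 0) m)) hP d

theorem symbPow_succ_mul_le (hn : 3 ≤ n) (j : ℕ) :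
    symbPow K n ((j + 1) * n) ≤ symbPow K n n * symbPow K n (j * n) := by
  intro P hP
  have hn0 : 0 < n := by omega
  rw [← sum_homogeneousComponent P]
  refine sum_mem fun d _ => ?_
  have hPd := homogeneousComponent_mem_symbPow hP d
  have hhom := homogeneousComponent_isHomogeneous d P
  rw [sum_monomial_mul_expand_residuePart (n := n) (homogeneousComponent d P)]
  refine sum_mem fun e _ => ?_
  have hspan := residuePart_mem_span_lineProds hn0 hhom hPd e
  generalize residuePart K n e (homogeneousComponent d P) = R at hspan ⊢
  induction hspan using Submodule.span_induction with
  | zero => simp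
  | add P Q _ _ hP hQ => rw [map_add, mul_add]; exact add_mem hP hQ
  | smul c P _ hP => rw [map_smul, mul_smul_comm, smul_eq_C_mul]; exact Ideal.mul_mem_left _ _ hP
  | mem Q hQ =>
    obtain ⟨A, B, C, D, E, F, h0, h1, h2, h3, rfl⟩ := hQ
    rw [monomial_mul_expand_lineProd]
    have key (a b u v w : ℕ) (h : j + 1 - (a + b) / n ≤ u + v + w) :
        (j + 1) * n ≤ a + n * u + (b + n * v) + n * w := by
      have hle : j + 1 ≤ u + v + w + (a + b) / n := by omega
      calc (j + 1) * n ≤ (u + v + w + (a + b) / n) * n := Nat.mul_le_mul_right n hle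
        _ = (u + v + w) * n + (a + b) / n * n := add_mul _ _ _
        _ ≤ (u + v + w) * n + (a + b) := by gcongr; exact Nat.div_mul_le_self _ _
        _ = a + n * u + (b + n * v) + n * w := by ring
    exact lineProd_mem_symbPow_mul hn h0 (key _ _ _ _ _ h1) (key _ _ _ _ _ h2)
      (key _ _ _ _ _ h3)

end SymbolicPowers

/-- for `n ≥ 3` and `k ≥ 2`, `I^{(kn)} = I^{(n)} · I^{((k−1)n)}` for the
Fermat ideal (in particular `I^{(kn)} ⊆ I^{(n)} · I^{((k−1)n)}`). -/
theorem fermat_symbolic_product {K : Type*} [Field K] (n k : ℕ) (hn : 3 ≤ n) (hk : 2 ≤ k)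
    (hζ : ∃ ζ : K, IsPrimitiveRoot ζ n) (hinv : IsUnit (n : K)) :
    symbPow K n (k * n) = symbPow K n n * symbPow K n ((k - 1) * n) := by
  obtain ⟨j, rfl⟩ : ∃ j, k = j + 1 := ⟨k - 1, by omega⟩
  rw [Nat.add_sub_cancel]
  refine le_antisymm (symbPow_succ_mul_le hn j) ((symbPow_mul_le n (j * n)).trans_eq ?_)
  rw [add_mul, one_mul, add_comm]
end
end

section
/- For all integers n ≥ 3 and k ≥ 1, the nk-th symbolic power of the Fermat ideal equals the k-th ordinary power of its n-th symbolic power: I^{(nk)} = (I^{(n)})^k. -/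
open MvPolynomial

noncomputable section

namespace FermatIdeal

open scoped Pointwise in
theorem span_pow_le_span_inter {R : Type*} [CommSemiring R] {S : Set R} {M : Submonoid R}
    (hS : S ⊆ M) (m : ℕ) : Ideal.span S ^ m ≤ Ideal.span {q ∈ Ideal.span S ^ m | q ∈ M} := by
  have hpow : Ideal.span S ^ m = Ideal.span (S ^ m) := Submodule.span_pow S m
  conv_lhs => rw [hpow]
  exact Ideal.span_mono fun q hq =>
    ⟨hpow ▸ Ideal.subset_span hq, Submonoid.pow_subset hS hq⟩

/-- If the ideal `J` is generated by polynomials that do not involve the variable `X i`, then a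
polynomial `X i ^ n - d` with `d` free of `X i` is a nonzerodivisor modulo `J`. -/
theorem mem_of_X_pow_sub_mul_mem {σ K : Type*} [CommRing K] (i : σ) {J : Ideal (MvPolynomial σ K)}
    (hJ : J ≤ Ideal.span {q ∈ J | q ∈ supported K {i}ᶜ})
    {d : MvPolynomial σ K} (hd : d ∈ supported K {i}ᶜ) {n : ℕ} (hn : n ≠ 0)
    {u : MvPolynomial σ K} (hu : (X i ^ n - d) * u ∈ J) : u ∈ J := by
  classical
  let ι : MvPolynomial σ K →ₐ[K] Polynomial (MvPolynomial σ K ⧸ J) :=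
    Polynomial.CAlgHom.comp (Ideal.Quotient.mkₐ K J)
  let ψ : MvPolynomial σ K →ₐ[K] Polynomial (MvPolynomial σ K ⧸ J) :=
    aeval fun t => if t = i then Polynomial.X else ι (X t)
  have hψι : ∀ q ∈ supported K ({i}ᶜ : Set σ), ψ q = ι q := by
    intro q hq
    refine AlgHom.eqOn_adjoin_iff.2 ?_ hq
    rintro _ ⟨t, ht, rfl⟩
    have : t ≠ i := ht
    simp [ψ, this]
  have hker : J ≤ RingHom.ker ψ := by
    refine hJ.trans (Ideal.span_le.2 fun q hq => ?_)
    simp [RingHom.mem_ker, hψι q hq.2, ι, Ideal.Quotient.eq_zero_iff_mem.2 hq.1]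
  have hmonic : (ψ (X i ^ n - d)).Monic := by
    rw [map_sub, hψι d hd]
    simpa [ψ, ι] using Polynomial.monic_X_pow_sub_C (Ideal.Quotient.mk J d) hn
  have hψu : ψ u = 0 := by
    have := hker hu
    rw [RingHom.mem_ker, map_mul] at this
    exact (hmonic.mul_right_eq_zero_iff).1 this
  have heval : ((Polynomial.aeval (Ideal.Quotient.mk J (X i))).restrictScalars K).comp ψ =
      Ideal.Quotient.mkₐ K J := by
    ext t
    by_cases ht : t = i <;> simp [ψ, ι, ht]
  have := DFunLike.congr_fun heval u
  simp only [AlgHom.comp_apply, hψu, map_zero] at this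
  exact Ideal.Quotient.eq_zero_iff_mem.1 this.symm

section Order

variable {σ K : Type*} [CommRing K] [DecidableEq σ] (j k : σ)

/-- The substitution multiplying the variables `X j` and `X k` by a new variable. -/
def dilation : MvPolynomial σ K →ₐ[K] Polynomial (MvPolynomial σ K) :=
  aeval fun t => Polynomial.C (X t) * if t = j ∨ t = k then Polynomial.X else 1

theorem coeff_dilation_mem (p : MvPolynomial σ K) (d : ℕ) :
    (dilation j k p).coeff d ∈ Ideal.span {X j, X k} ^ d := by
  induction p using MvPolynomial.induction_on generalizing d with
  | C a =>
    rw [← algebraMap_eq, AlgHom.commutes, IsScalarTower.algebraMap_apply K (MvPolynomial σ K),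
      Polynomial.algebraMap_apply, Polynomial.coeff_C]
    split_ifs with h
    · simp [h]
    · exact zero_mem _
  | add p q hp hq => simpa using add_mem (hp d) (hq d)
  | mul_X p t hp =>
    have hX : dilation j k (X t : MvPolynomial σ K) =
        Polynomial.C (X t) * if t = j ∨ t = k then Polynomial.X else 1 := by simp [dilation]
    rw [map_mul, hX, mul_left_comm, Polynomial.coeff_C_mul]
    split_ifs with h
    · rcases d with _ | d
      · simp
      · rw [Polynomial.coeff_mul_X, pow_succ']
        refine Ideal.mul_mem_mul (Ideal.subset_span ?_) (hp d)
        rcases h with rfl | rfl <;> simp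
    · rw [mul_one]
      exact Ideal.mul_mem_left _ _ (hp d)

theorem mem_pow_iff_X_pow_dvd_dilation {p : MvPolynomial σ K} {b : ℕ} :
    p ∈ Ideal.span {X j, X k} ^ b ↔ Polynomial.X ^ b ∣ dilation j k p := by
  constructor
  · intro hp
    have hle : Ideal.span {X j, X k} ≤
        (Ideal.span {Polynomial.X}).comap (dilation (K := K) j k) := by
      rw [Ideal.span_le]
      rintro q (rfl | rfl) <;> simp [dilation, Ideal.mem_span_singleton]
    have := Ideal.pow_right_mono hle b hp
    have := Ideal.le_comap_pow _ _ this
    rwa [Ideal.mem_comap, Ideal.span_singleton_pow, Ideal.mem_span_singleton] at this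
  · intro hp
    have heval : ((Polynomial.aeval (1 : MvPolynomial σ K)).restrictScalars K).comp
        (dilation j k) = AlgHom.id K _ := by
      ext t : 1
      by_cases ht : t = j ∨ t = k <;> simp [dilation, ht]
    have hsum := DFunLike.congr_fun heval p
    simp only [AlgHom.comp_apply, AlgHom.restrictScalars_apply, Polynomial.aeval_eq_sum_range,
      one_pow, smul_eq_mul, mul_one, AlgHom.id_apply] at hsum
    rw [← hsum]
    refine sum_mem fun d _ => ?_
    rcases lt_or_ge d b with hd | hd
    · rw [Polynomial.X_pow_dvd_iff.1 hp d hd]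
      exact zero_mem _
    · exact Ideal.pow_le_pow_right hd (coeff_dilation_mem j k p d)

theorem mem_pow_of_X_pow_sub_X_pow_mul_mem [IsDomain K] {j k : σ} (hjk : j ≠ k) {n : ℕ}
    (hn : n ≠ 0) {b : ℕ} {u : MvPolynomial σ K}
    (hu : (X j ^ n - X k ^ n) * u ∈ Ideal.span {X j, X k} ^ (n + b)) :
    u ∈ Ideal.span {X j, X k} ^ b := by
  rw [mem_pow_iff_X_pow_dvd_dilation] at hu ⊢
  have hf : dilation j k (X j ^ n - X k ^ n : MvPolynomial σ K) =
      Polynomial.X ^ n * Polynomial.C (X j ^ n - X k ^ n) := by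
    simp [dilation]
    ring
  have hne : (X j ^ n - X k ^ n : MvPolynomial σ K) ≠ 0 := by
    intro h
    have := congrArg (aeval fun t => if t = j then (1 : K) else 0) h
    simp [hjk.symm, hn] at this
  rw [map_mul, hf, pow_add, mul_assoc] at hu
  have hu := (mul_dvd_mul_iff_left (pow_ne_zero n Polynomial.X_ne_zero)).1 hu
  rw [Polynomial.X_pow_dvd_iff] at hu ⊢
  intro d hd
  have := hu d hd
  rw [Polynomial.coeff_C_mul] at this
  exact (mul_eq_zero.1 this).resolve_left hne

end Order

section Ring

variable {R : Type*} [CommRing R]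

/-- The properties of `f, g, h`, the ideal `L = (f, g) = (f, h)` and the ideals `A, B, C` of the
coordinate points that allow one to split off the element `f`. -/
structure IsSplitting (n : ℕ) (f g h : R) (L A B C : Ideal R) : Prop where
  f_mem : f ∈ L
  g_mem : g ∈ L
  h_mem : h ∈ L
  le_sup_g : L ≤ Ideal.span {g} ⊔ Ideal.span {f}
  le_sup_h : L ≤ Ideal.span {h} ⊔ Ideal.span {f}
  f_mem_pow : f ∈ A ^ n
  g_mem_pow : g ∈ B ^ n
  h_mem_pow : h ∈ C ^ n
  mem_sup_of_g_mul_mem : ∀ b u, g * u ∈ A ^ b ⊔ Ideal.span {f} → u ∈ A ^ b ⊔ Ideal.span {f}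
  mem_sup_of_h_mul_mem : ∀ b u, h * u ∈ A ^ b ⊔ Ideal.span {f} → u ∈ A ^ b ⊔ Ideal.span {f}
  mem_of_f_mul_mem_A : ∀ b u, f * u ∈ A ^ (n + b) → u ∈ A ^ b
  mem_of_f_mul_mem_B : ∀ b u, f * u ∈ B ^ b → u ∈ B ^ b
  mem_of_f_mul_mem_C : ∀ b u, f * u ∈ C ^ b → u ∈ C ^ b

theorem pow_succ_le_span_mul_sup {L : Ideal R} {f e q : R} {m : ℕ}
    (he : L ≤ Ideal.span {e} ⊔ Ideal.span {f}) (hq : q ∈ L ^ m)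
    (hm : L ^ m ≤ Ideal.span {q} ⊔ Ideal.span {f} * L ^ (m - 1)) :
    L ^ (m + 1) ≤ Ideal.span {q * e} ⊔ Ideal.span {f} * L ^ m := by
  have hL : L ^ (m - 1) * L ≤ L ^ m := by
    rw [← pow_succ]
    exact Ideal.pow_le_pow_right (by omega)
  have hqL : Ideal.span {q} ≤ L ^ m := by simpa [Ideal.span_singleton_le_iff_mem] using hq
  calc L ^ (m + 1) = L ^ m * L := pow_succ _ _
    _ ≤ (Ideal.span {q} ⊔ Ideal.span {f} * L ^ (m - 1)) * L := Ideal.mul_mono_left hm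
    _ = Ideal.span {q} * L ⊔ Ideal.span {f} * (L ^ (m - 1) * L) := by
      rw [Ideal.sup_mul, mul_assoc]
    _ ≤ Ideal.span {q} * (Ideal.span {e} ⊔ Ideal.span {f}) ⊔ Ideal.span {f} * L ^ m :=
      sup_le_sup (Ideal.mul_mono_right he) (Ideal.mul_mono_right hL)
    _ = Ideal.span {q * e} ⊔ Ideal.span {f} * Ideal.span {q} ⊔ Ideal.span {f} * L ^ m := by
      rw [Ideal.mul_sup, Ideal.span_singleton_mul_span_singleton, mul_comm (Ideal.span {q})]
    _ ≤ Ideal.span {q * e} ⊔ Ideal.span {f} * L ^ m := by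
      rw [sup_assoc]
      exact sup_le_sup le_rfl (sup_le (Ideal.mul_mono_right hqL) le_rfl)

namespace IsSplitting

variable {n : ℕ} {f g h : R} {L A B C : Ideal R}

theorem g_pow_mul_h_pow_mem (H : IsSplitting n f g h L A B C)
    (b c : ℕ) : g ^ b * h ^ c ∈ L ^ (b + c) := by
  rw [pow_add]
  exact Ideal.mul_mem_mul (Ideal.pow_mem_pow H.g_mem b) (Ideal.pow_mem_pow H.h_mem c)

theorem pow_le_span_sup (H : IsSplitting n f g h L A B C)
    (b c : ℕ) :
    L ^ (b + c) ≤ Ideal.span {g ^ b * h ^ c} ⊔ Ideal.span {f} * L ^ (b + c - 1) := by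
  induction c with
  | zero =>
    induction b with
    | zero => simp
    | succ b ih =>
      have := pow_succ_le_span_mul_sup H.le_sup_g (H.g_pow_mul_h_pow_mem b 0) ih
      simpa [pow_succ] using this
  | succ c ih =>
    have := pow_succ_le_span_mul_sup H.le_sup_h (H.g_pow_mul_h_pow_mem b c) ih
    rwa [mul_assoc, ← pow_succ] at this

theorem mem_sup_of_pow_mul_mem (H : IsSplitting n f g h L A B C)
    (a b c : ℕ) {u : R}
    (hu : g ^ b * h ^ c * u ∈ A ^ a ⊔ Ideal.span {f}) : u ∈ A ^ a ⊔ Ideal.span {f} := by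
  induction b with
  | zero =>
    induction c with
    | zero => simpa using hu
    | succ c ih =>
      refine ih (H.mem_sup_of_h_mul_mem _ _ ?_)
      convert hu using 1
      ring
  | succ b ih =>
    refine ih (H.mem_sup_of_g_mul_mem _ _ ?_)
    convert hu using 1
    ring

theorem exists_eq_add_f_mul (H : IsSplitting n f g h L A B C)
    (a b c : ℕ) {p : R} (hL : p ∈ L ^ (b + c)) (hA : p ∈ A ^ (n + a)) :
    ∃ s ∈ A ^ (n + a), ∃ p' ∈ L ^ (b + c - 1), p' ∈ A ^ a ∧ p = g ^ b * h ^ c * s + f * p' := by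
  obtain ⟨x, hx, y, hy, hxy⟩ := Submodule.mem_sup.1 (H.pow_le_span_sup b c hL)
  obtain ⟨s, rfl⟩ := Ideal.mem_span_singleton.1 hx
  obtain ⟨t, ht, rfl⟩ := Ideal.mem_span_singleton_mul.1 hy
  have hs : s ∈ A ^ (n + a) ⊔ Ideal.span {f} := by
    refine H.mem_sup_of_pow_mul_mem _ b c ?_
    rw [eq_sub_of_add_eq hxy]
    exact sub_mem (Ideal.mem_sup_left hA)
      (Ideal.mem_sup_right (Ideal.mul_mem_right _ _ (Ideal.mem_span_singleton_self f)))
  obtain ⟨s₀, hs₀, r, hr, rfl⟩ := Submodule.mem_sup.1 hs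
  obtain ⟨s₁, rfl⟩ := Ideal.mem_span_singleton.1 hr
  have hp : p = g ^ b * h ^ c * s₀ + f * (t + g ^ b * h ^ c * s₁) := by
    rw [← hxy]
    ring
  refine ⟨s₀, hs₀, _, ?_, H.mem_of_f_mul_mem_A _ _ ?_, hp⟩
  · exact add_mem ht (Ideal.mul_mem_right _ _
      (Ideal.pow_le_pow_right (Nat.sub_le _ _) (H.g_pow_mul_h_pow_mem b c)))
  · rw [← sub_eq_of_eq_add' hp]
    exact sub_mem hA (Ideal.mul_mem_left _ _ hs₀)

/-- To show `q * p ∈ N`, one may split off `f` from `p` repeatedly. -/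
theorem mul_mem_of_splitting (H : IsSplitting n f g h L A B C)
    {N : Ideal R} (a b c : ℕ) {m : ℕ} (hm : a + b + c ≤ m) (q : R) {p : R}
    (hL : p ∈ L ^ m) (hA : p ∈ A ^ (n * a)) (hB : p ∈ B ^ (n * b)) (hC : p ∈ C ^ (n * c))
    (hN : ∀ u v, u + v = a → ∀ s ∈ A ^ (n * v), ∀ w ∈ L ^ (m - u - b - c),
      q * (f ^ u * g ^ b * h ^ c * s * w) ∈ N)
    (hfin : ∀ p' ∈ L ^ (m - a), p' ∈ B ^ (n * b) → p' ∈ C ^ (n * c) → q * f ^ a * p' ∈ N) :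
    q * p ∈ N := by
  induction a generalizing m q p with
  | zero => simpa using hfin p hL hB hC
  | succ a ih =>
    have hbm : b + (m - b) = m := by omega
    rw [mul_add, mul_one, add_comm] at hA
    obtain ⟨s, hs, p', hp'L, hp'A, rfl⟩ :=
      H.exists_eq_add_f_mul (n * a) b (m - b) (p := p) (by rwa [hbm]) hA
    rw [hbm] at hp'L
    have hgB : g ^ b * h ^ (m - b) * s ∈ B ^ (n * b) := by
      rw [pow_mul, mul_assoc]
      exact Ideal.mul_mem_right _ _ (Ideal.pow_mem_pow H.g_mem_pow b)
    have hhC : g ^ b * h ^ (m - b) * s ∈ C ^ (n * c) := by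
      rw [pow_mul]
      exact Ideal.mul_mem_right _ _ (Ideal.mul_mem_left _ _
        (Ideal.pow_le_pow_right (by omega) (Ideal.pow_mem_pow H.h_mem_pow (m - b))))
    rw [mul_add, ← mul_assoc q f]
    refine add_mem ?_ (ih (m := m - 1) (by omega) (q * f) hp'L hp'A
      (H.mem_of_f_mul_mem_B _ _ ((add_mem_cancel_left hgB).1 hB))
      (H.mem_of_f_mul_mem_C _ _ ((add_mem_cancel_left hhC).1 hC)) ?_ ?_)
    · have := hN 0 (a + 1) (zero_add _) s (by rwa [mul_add, mul_one, add_comm]) (h ^ (m - b - c))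
        (by simpa using Ideal.pow_mem_pow H.h_mem (m - b - c))
      convert this using 1
      rw [show m - b = c + (m - b - c) by omega, pow_add]
      simp
      ring
    · intro u v huv s hs w hw
      have := hN (u + 1) v (by omega) s hs w (by rwa [show m - (u + 1) = m - 1 - u by omega])
      convert this using 1
      ring
    · intro x hxL hxB hxC
      have := hfin x (by rwa [show m - (a + 1) = m - 1 - a by omega]) hxB hxC
      convert this using 1
      ring

theorem mul_mem_pow (H : IsSplitting n f g h L A B C)
    {J : Ideal R} (hn : 3 ≤ n)
    (hJ : ∀ x ∈ L ^ n, x ∈ A ^ n → x ∈ B ^ n → x ∈ C ^ n → x ∈ J) {u v k m : ℕ}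
    (huv : u + v = k) (hm : m = n * k - 2 * k - u) {s w : R} (hs : s ∈ A ^ (n * v))
    (hw : w ∈ L ^ m) : f ^ u * g ^ k * h ^ k * s * w ∈ J ^ k := by
  obtain ⟨r, rfl⟩ := Nat.exists_eq_add_of_le hn
  have hghL : g * h ∈ L ^ 2 := by simpa using H.g_pow_mul_h_pow_mem 1 1
  have hfghL : f * (g * h) ∈ L ^ 3 := by
    rw [pow_succ']
    exact Ideal.mul_mem_mul H.f_mem hghL
  have h₁ : Ideal.span {f * (g * h)} * L ^ r ≤ J := by
    rw [Ideal.span_singleton_mul_le_iff]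
    intro z hz
    refine hJ _ ?_ ?_ ?_ ?_
    · rw [pow_add]
      exact Ideal.mul_mem_mul hfghL hz
    · exact Ideal.mul_mem_right _ _ (Ideal.mul_mem_right _ _ H.f_mem_pow)
    · exact Ideal.mul_mem_right _ _ (Ideal.mul_mem_left _ _ (Ideal.mul_mem_right _ _ H.g_mem_pow))
    · exact Ideal.mul_mem_right _ _ (Ideal.mul_mem_left _ _ (Ideal.mul_mem_left _ _ H.h_mem_pow))
  have h₂ : Ideal.span {g * h} * (A ^ (3 + r) * L ^ (r + 1)) ≤ J := by
    have hle_left : A ^ (3 + r) * L ^ (r + 1) ≤ A ^ (3 + r) := Ideal.mul_le_left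
    have hle_right : A ^ (3 + r) * L ^ (r + 1) ≤ L ^ (r + 1) := Ideal.mul_le_right
    rw [Ideal.span_singleton_mul_le_iff]
    intro z hz
    refine hJ _ ?_ ?_ ?_ ?_
    · rw [show 3 + r = 2 + (r + 1) by ring, pow_add]
      exact Ideal.mul_mem_mul hghL (hle_right hz)
    · exact Ideal.mul_mem_left _ _ (hle_left hz)
    · exact Ideal.mul_mem_right _ _ (Ideal.mul_mem_right _ _ H.g_mem_pow)
    · exact Ideal.mul_mem_right _ _ (Ideal.mul_mem_left _ _ H.h_mem_pow)
  have hle := Ideal.mul_mono (Ideal.pow_right_mono h₁ u) (Ideal.pow_right_mono h₂ v)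
  rw [← pow_add, huv] at hle
  apply hle
  have hm' : m = r * u + (r + 1) * v := by
    subst huv
    have : (3 + r) * (u + v) = r * u + (r + 1) * v + u + 2 * (u + v) := by ring
    omega
  have hideal : (Ideal.span {f * (g * h)} * L ^ r) ^ u *
      (Ideal.span {g * h} * (A ^ (3 + r) * L ^ (r + 1))) ^ v =
      Ideal.span {(f * (g * h)) ^ u * (g * h) ^ v} * A ^ ((3 + r) * v) * L ^ m := by
    rw [hm', ← Ideal.span_singleton_mul_span_singleton ((f * (g * h)) ^ u),
      ← Ideal.span_singleton_pow, ← Ideal.span_singleton_pow]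
    ring
  have hel : f ^ u * g ^ k * h ^ k * s * w = (f * (g * h)) ^ u * (g * h) ^ v * s * w := by
    subst huv
    ring
  rw [hideal, hel]
  exact Ideal.mul_mem_mul (Ideal.mul_mem_mul (Ideal.mem_span_singleton_self _) hs) hw

theorem mem_pow_of_splittings {J : Ideal R} (hn : 3 ≤ n) (k : ℕ)
    (Hf : IsSplitting n f g h L A B C) (Hg : IsSplitting n g h f L B C A)
    (Hh : IsSplitting n h f g L C A B)
    (hJ : ∀ x ∈ L ^ n, x ∈ A ^ n → x ∈ B ^ n → x ∈ C ^ n → x ∈ J) {p : R}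
    (hL : p ∈ L ^ (n * k)) (hA : p ∈ A ^ (n * k)) (hB : p ∈ B ^ (n * k))
    (hC : p ∈ C ^ (n * k)) : p ∈ J ^ k := by
  have hnk : 3 * k ≤ n * k := Nat.mul_le_mul_right k hn
  rw [← one_mul p]
  refine Hf.mul_mem_of_splitting k k k (by omega) 1 hL hA hB hC ?_ ?_
  · intro u v huv s hs w hw
    rw [one_mul]
    exact Hf.mul_mem_pow hn hJ huv (by omega) hs hw
  intro p₁ hL₁ hB₁ hC₁
  refine Hg.mul_mem_of_splitting k k 0 (by omega) _ hL₁ hB₁ hC₁ (by simp) ?_ ?_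
  · intro u v huv s hs w hw
    convert Hg.mul_mem_pow hn (fun x hL hB hC hA => hJ x hL hA hB hC) huv
      (m := n * k - k - u - k - 0) (by omega) hs hw using 1
    ring
  intro p₂ hL₂ hC₂ _
  refine Hh.mul_mem_of_splitting k 0 0 (by omega) _ hL₂ hC₂ (by simp) (by simp) ?_ ?_
  · intro u v huv s hs w hw
    convert Hh.mul_mem_pow hn (fun x hL hC hA hB => hJ x hL hA hB hC) huv
      (m := n * k - k - k - u - 0 - 0) (by omega) hs hw using 1
    ring
  intro p₃ hL₃ _ _
  convert Hf.mul_mem_pow hn hJ (add_zero k) (m := n * k - k - k - k) (by omega)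
    (s := 1) (by simp) hL₃ using 1
  ring

end IsSplitting

end Ring

section Fermat

variable {σ K : Type*} [CommRing K] {n : ℕ}

theorem mem_of_X_pow_sub_X_pow_mul_mem_sup (hn : n ≠ 0) {i a b e : σ} (ha : a ≠ i) (hb : b ≠ i)
    (he : e ≠ i) {c : MvPolynomial σ K} (hc : c ∈ supported K {i}ᶜ) (m : ℕ) {u : MvPolynomial σ K}
    (hu : (X i ^ n - X e ^ n) * u ∈ Ideal.span {X a, X b} ^ m ⊔ Ideal.span {c}) :
    u ∈ Ideal.span {X a, X b} ^ m ⊔ Ideal.span {c} := by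
  have hX : ∀ t : σ, t ≠ i → (X t : MvPolynomial σ K) ∈ supported K {i}ᶜ :=
    fun t ht => Algebra.subset_adjoin (Set.mem_image_of_mem _ ht)
  refine mem_of_X_pow_sub_mul_mem i (sup_le ?_ ?_) (pow_mem (hX e he) n) hn hu
  · have hsub : ({X a, X b} : Set (MvPolynomial σ K)) ⊆ (supported K {i}ᶜ).toSubmonoid := by
      rintro q (rfl | rfl)
      exacts [hX a ha, hX b hb]
    exact (span_pow_le_span_inter hsub m).trans
      (Ideal.span_mono fun q hq => ⟨Ideal.mem_sup_left hq.1, hq.2⟩)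
  · exact Ideal.span_mono (Set.singleton_subset_iff.2
      ⟨Ideal.mem_sup_right (Ideal.mem_span_singleton_self c), hc⟩)

theorem mem_of_X_pow_sub_X_pow_mul_mem (hn : n ≠ 0) {i a b e : σ} (ha : a ≠ i) (hb : b ≠ i)
    (he : e ≠ i) (m : ℕ) {u : MvPolynomial σ K}
    (hu : (X i ^ n - X e ^ n) * u ∈ Ideal.span {X a, X b} ^ m) :
    u ∈ Ideal.span {X a, X b} ^ m := by
  simpa using mem_of_X_pow_sub_X_pow_mul_mem_sup hn ha hb he (zero_mem _) m
    (Ideal.mem_sup_left hu)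

theorem X_pow_sub_X_pow_mem (a b : σ) :
    (X a ^ n - X b ^ n : MvPolynomial σ K) ∈ Ideal.span {X a, X b} ^ n :=
  sub_mem (Ideal.pow_mem_pow (Ideal.subset_span (by simp)) n)
    (Ideal.pow_mem_pow (Ideal.subset_span (by simp)) n)

theorem neg_sub_mul_mem {R : Type*} [CommRing R] {I : Ideal R} {a b u : R}
    (h : (a - b) * u ∈ I) : (b - a) * u ∈ I := by
  rw [← neg_sub, neg_mul]
  exact neg_mem h

theorem isSplitting [IsDomain K] [DecidableEq σ] (hn : n ≠ 0) {i j k : σ} (hij : i ≠ j)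
    (hjk : j ≠ k) (hki : k ≠ i) {L : Ideal (MvPolynomial σ K)}
    (hL : L = Ideal.span {X j ^ n - X k ^ n, X k ^ n - X i ^ n}) :
    IsSplitting n (X j ^ n - X k ^ n : MvPolynomial σ K) (X k ^ n - X i ^ n) (X i ^ n - X j ^ n) L
      (Ideal.span {X j, X k}) (Ideal.span {X k, X i}) (Ideal.span {X i, X j}) := by
  have hf : (X j ^ n - X k ^ n : MvPolynomial σ K) ∈ L := hL ▸ Ideal.subset_span (by simp)
  have hg : (X k ^ n - X i ^ n : MvPolynomial σ K) ∈ L := hL ▸ Ideal.subset_span (by simp)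
  have hsupp : (X j ^ n - X k ^ n : MvPolynomial σ K) ∈ supported K ({i}ᶜ : Set σ) :=
    sub_mem (pow_mem (Algebra.subset_adjoin (Set.mem_image_of_mem _ hij.symm)) n)
      (pow_mem (Algebra.subset_adjoin (Set.mem_image_of_mem _ hki)) n)
  have hswap (m : ℕ) (u : MvPolynomial σ K) (t : σ) (ht : t ≠ i) :=
    mem_of_X_pow_sub_X_pow_mul_mem_sup hn hij.symm hki ht hsupp m (u := u)
  refine ⟨hf, hg, ?_, ?_, ?_, X_pow_sub_X_pow_mem j k, X_pow_sub_X_pow_mem k i,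
    X_pow_sub_X_pow_mem i j, ?_, ?_, ?_, ?_, ?_⟩
  · rw [show (X i ^ n - X j ^ n : MvPolynomial σ K) =
      -((X j ^ n - X k ^ n) + (X k ^ n - X i ^ n)) by ring]
    exact neg_mem (add_mem hf hg)
  · rw [hL, Ideal.span_insert, sup_comm]
  · rw [hL, Ideal.span_le]
    rintro q (rfl | rfl)
    · exact Ideal.mem_sup_right (Ideal.mem_span_singleton_self _)
    · rw [show (X k ^ n - X i ^ n : MvPolynomial σ K) =
        -(X i ^ n - X j ^ n) + -(X j ^ n - X k ^ n) by ring]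
      exact add_mem (Ideal.mem_sup_left (neg_mem (Ideal.mem_span_singleton_self _)))
        (Ideal.mem_sup_right (neg_mem (Ideal.mem_span_singleton_self _)))
  · exact fun b u hu => hswap b u k hki (neg_sub_mul_mem hu)
  · exact fun b u hu => hswap b u j hij.symm hu
  · exact fun b u hu => mem_pow_of_X_pow_sub_X_pow_mul_mem hjk hn hu
  · exact fun b u hu => mem_of_X_pow_sub_X_pow_mul_mem hn hjk.symm hij hjk.symm b hu
  · exact fun b u hu =>
      mem_of_X_pow_sub_X_pow_mul_mem hn hki.symm hjk hjk b (neg_sub_mul_mem hu)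

theorem span_sub_sub_rotate {R : Type*} [CommRing R] (a b c : R) :
    Ideal.span {a - b, b - c} = Ideal.span {b - c, c - a} := by
  apply le_antisymm <;> rw [Ideal.span_le, Set.insert_subset_iff, Set.singleton_subset_iff]
  · refine ⟨?_, Ideal.subset_span (by simp)⟩
    rw [show a - b = -(b - c) + -(c - a) by ring]
    exact add_mem (neg_mem (Ideal.subset_span (by simp))) (neg_mem (Ideal.subset_span (by simp)))
  · refine ⟨Ideal.subset_span (by simp), ?_⟩
    rw [show c - a = -(a - b) + -(b - c) by ring]
    exact add_mem (neg_mem (Ideal.subset_span (by simp))) (neg_mem (Ideal.subset_span (by simp)))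

end Fermat

end FermatIdeal

/-- for `n ≥ 3` and `k ≥ 1`, `I^{(nk)} = (I^{(n)})^k` for the Fermat
ideal. -/
theorem fermat_symbolic_power_of_nth {K : Type*} [Field K] (n k : ℕ) (hn : 3 ≤ n)
    (hk : 1 ≤ k) (hζ : ∃ ζ : K, IsPrimitiveRoot ζ n) (hinv : IsUnit (n : K)) :
    symbPow K n (n * k) = (symbPow K n n) ^ k := by
  have hn0 : n ≠ 0 := by omega
  apply le_antisymm
  · rintro p ⟨⟨⟨hL, hxy⟩, hyz⟩, hzx⟩
    have hf := FermatIdeal.isSplitting (K := K) (i := (0 : Fin 3)) (j := 1) (k := 2)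
      (L := Ifg K n) hn0 (by decide) (by decide) (by decide) rfl
    have hg := FermatIdeal.isSplitting (K := K) (i := (1 : Fin 3)) (j := 2) (k := 0)
      (L := Ifg K n) hn0 (by decide) (by decide) (by decide)
      (FermatIdeal.span_sub_sub_rotate _ _ _)
    have hh := FermatIdeal.isSplitting (K := K) (i := (2 : Fin 3)) (j := 0) (k := 1)
      (L := Ifg K n) hn0 (by decide) (by decide) (by decide)
      ((FermatIdeal.span_sub_sub_rotate _ _ _).trans (FermatIdeal.span_sub_sub_rotate _ _ _))
    exact FermatIdeal.IsSplitting.mem_pow_of_splittings hn k hf hg hh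
      (fun x hL hyz hzx hxy => show x ∈ symbPow K n n from ⟨⟨⟨hL, hxy⟩, hyz⟩, hzx⟩) hL hyz hzx hxy
  · simp only [symbPow, pow_mul]
    refine le_inf (le_inf (le_inf ?_ ?_) ?_) ?_ <;> apply Ideal.pow_right_mono
    · exact inf_le_left.trans (inf_le_left.trans inf_le_left)
    · exact inf_le_left.trans (inf_le_left.trans inf_le_right)
    · exact inf_le_left.trans inf_le_right
    · exact inf_le_right
end
end
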